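/- Suppose α, β ∈ (0,π), μ : ℕ → ℝ is a strictly increasing sequence enumerating precisely the eigenvalues of L(q,α,β), and Φ(λ) = φ(π,λ)·cos β + φ'(π,λ)·sin β is the characteristic function, where φ(·,λ) is the solution with φ(0,λ) = sin α, φ'(0,λ) = −cos α. Then for every n ≥ 1 the infinite product ∏_{k≥1, k≠n} (μ_k − μₙ)/k² converges and the derivative of Φ at μₙ equals Φ̇(μₙ) = −(π/n²)·(μ₀ − μₙ)·sin α·sin β·∏_{k≥1, k≠n} (μ_k − μₙ)/k². -/

import Mathlib

open Real MeasureTheory Set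

noncomputable section

/-- `y` (with derivative `y'`) solves `-y'' + Q y = μ y` on `[0, π]`:
`y` is differentiable with derivative `y'`, and
`y' x = y' 0 + ∫ t in 0..x, (Q t - μ) * y t` for all `x ∈ [0, π]`. -/
def IsSol (Q : ℝ → ℝ) (μ : ℝ) (y y' : ℝ → ℝ) : Prop :=
  (∀ x ∈ Set.Icc (0 : ℝ) π, HasDerivAt y (y' x) x) ∧
  (∀ x ∈ Set.Icc (0 : ℝ) π, y' x = y' 0 + ∫ t in (0 : ℝ)..x, (Q t - μ) * y t)

/-- `μ` is an eigenvalue of the Sturm–Liouville problem `L(Q, γ, δ)`. -/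
def IsEigenvalue (Q : ℝ → ℝ) (γ δ : ℝ) (μ : ℝ) : Prop :=
  ∃ y y' : ℝ → ℝ, IsSol Q μ y y' ∧
    (∃ x ∈ Set.Icc (0 : ℝ) π, y x ≠ 0) ∧
    y 0 * Real.cos γ + y' 0 * Real.sin γ = 0 ∧
    y π * Real.cos δ + y' π * Real.sin δ = 0


theorem ac_prim {r : ℝ → ℂ} (h : IntervalIntegrable r volume 0 π) :
    AbsolutelyContinuousOnInterval (fun x => ∫ t in (0:ℝ)..x, r t) 0 π := by
  have hpi := Real.pi_pos
  have hn := h.norm.absolutelyContinuousOnInterval_intervalIntegral (c := 0) (by simp)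
  rw [absolutelyContinuousOnInterval_iff] at hn ⊢
  intro ε hε
  obtain ⟨δ, hδ, H⟩ := hn ε hε
  refine ⟨δ, hδ, fun E hE hl => lt_of_le_of_lt (Finset.sum_le_sum ?_) (H E hE hl)⟩
  intro i hi
  have hm := hE.1 i hi
  have sub : ∀ a ∈ uIcc (0:ℝ) π, IntervalIntegrable r volume 0 a := fun a ha =>
    h.mono_set (uIcc_subset_uIcc (by simp) ha)
  have s1 := sub _ hm.1
  have s2 := sub _ hm.2
  rw [dist_eq_norm, Real.dist_eq, intervalIntegral.integral_interval_sub_left s1 s2,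
    intervalIntegral.integral_interval_sub_left s1.norm s2.norm]
  exact intervalIntegral.norm_integral_le_abs_integral_norm

theorem prim_mul {r1 r2 u v : ℝ → ℂ} (h1 : IntervalIntegrable r1 volume 0 π)
    (h2 : IntervalIntegrable r2 volume 0 π)
    (hu : ∀ x ∈ Icc (0:ℝ) π, u x = u 0 + ∫ t in (0:ℝ)..x, r1 t)
    (hv : ∀ x ∈ Icc (0:ℝ) π, v x = v 0 + ∫ t in (0:ℝ)..x, r2 t) :
    ∀ x ∈ Icc (0:ℝ) π, u x * v x = u 0 * v 0 + ∫ t in (0:ℝ)..x, (r1 t * v t + u t * r2 t) := by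
  have hpi := Real.pi_pos
  have hI : uIcc (0:ℝ) π = Icc 0 π := uIcc_of_le hpi.le
  set U : ℝ → ℂ := fun x => u 0 + ∫ t in (0:ℝ)..x, r1 t with hU
  set V : ℝ → ℂ := fun x => v 0 + ∫ t in (0:ℝ)..x, r2 t with hV
  have acc : ∀ c : ℂ, AbsolutelyContinuousOnInterval (fun _ : ℝ => c) 0 π := fun c =>
    (LipschitzOnWith.absolutelyContinuousOnInterval (K := 0) (by
      intro x _ y _; simp))
  have acU : AbsolutelyContinuousOnInterval U 0 π :=
    (acc _).add (ac_prim h1)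
  have acV : AbsolutelyContinuousOnInterval V 0 π :=
    (acc _).add (ac_prim h2)
  have hr : IntervalIntegrable (fun t => r1 t * V t + U t * r2 t) volume 0 π :=
    (h1.mul_continuousOn acV.continuousOn).add (h2.continuousOn_mul acU.continuousOn)
  have acW := (acU.smul acV).sub (ac_prim hr)
  obtain ⟨C, hC⟩ := acW.const_of_ae_hasDerivAt_zero (by
    filter_upwards [h1.ae_hasDerivAt_integral, h2.ae_hasDerivAt_integral, hr.ae_hasDerivAt_integral]
      with x a1 a2 a3 hx
    have b1 := (a1 hx 0 (by simp)).const_add (u 0)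
    have b2 := (a2 hx 0 (by simp)).const_add (v 0)
    have b3 := a3 hx 0 (by simp)
    have := (b1.mul b2).sub b3
    exact this.congr_deriv (sub_self _))
  intro x hx
  have e0 := hC 0 (by simp)
  have ex := hC x (by rwa [hI])
  have h00 : (0:ℝ) ∈ Icc (0:ℝ) π := ⟨le_rfl, hpi.le⟩
  simp only [Pi.sub_apply, smul_eq_mul, Pi.mul_apply, intervalIntegral.integral_same, sub_zero] at e0 ex
  have hcongr : ∫ t in (0:ℝ)..x, (r1 t * v t + u t * r2 t) = ∫ t in (0:ℝ)..x, (r1 t * V t + U t * r2 t) := by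
    apply intervalIntegral.integral_congr
    intro t ht
    rw [uIcc_of_le hx.1] at ht
    have ht' : t ∈ Icc (0:ℝ) π := ⟨ht.1, ht.2.trans hx.2⟩
    simp only [hU, hV]
    rw [← hu t ht', ← hv t ht']
  rw [hcongr]
  have hUx : U x = u x := (hu x hx).symm
  have hVx : V x = v x := (hv x hx).symm
  have hU0 : U 0 = u 0 := by simp [hU]
  have hV0 : V 0 = v 0 := by simp [hV]
  rw [hUx, hVx] at ex
  rw [hU0, hV0] at e0
  rw [e0, ← ex]; ring


abbrev CE := C(Icc (0:ℝ) π, ℂ)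

noncomputable def cext (y : CE) : ℝ → ℂ := IccExtend Real.pi_pos.le y

theorem cext_cont (y : CE) : Continuous (cext y) := y.continuous.Icc_extend'

theorem cext_apply (y : CE) {x : ℝ} (hx : x ∈ Icc (0:ℝ) π) : cext y x = y ⟨x, hx⟩ :=
  IccExtend_of_mem _ _ hx

theorem cext_norm (y : CE) (x : ℝ) : ‖cext y x‖ ≤ ‖y‖ := y.norm_coe_le_norm _

theorem ii_mul {f : ℝ → ℂ} (hf : IntervalIntegrable f volume 0 π) {g : ℝ → ℂ}
    (hg : ContinuousOn g (Icc 0 π)) :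
    IntervalIntegrable (fun t => f t * g t) volume 0 π :=
  hf.mul_continuousOn (by rwa [uIcc_of_le Real.pi_pos.le])

theorem ii_sub {f : ℝ → ℂ} (hf : IntervalIntegrable f volume 0 π) {x : ℝ} (hx : x ∈ Icc (0:ℝ) π) :
    IntervalIntegrable f volume 0 x :=
  hf.mono_set (uIcc_subset_uIcc (by simp) (by rwa [uIcc_of_le Real.pi_pos.le]))

theorem VVcont (f : ℝ → ℂ) (hf : IntervalIntegrable f volume 0 π) (y : CE) :
    Continuous (fun x : Icc (0:ℝ) π => ∫ t in (0:ℝ)..x, f t * cext y t) := by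
  have := intervalIntegral.continuousOn_primitive_interval' (ii_mul hf (cext_cont y).continuousOn)
    (a := 0) (by simp)
  rw [uIcc_of_le Real.pi_pos.le] at this
  exact this.domRestrict

noncomputable def VV (f : ℝ → ℂ) (hf : IntervalIntegrable f volume 0 π) : CE →L[ℂ] CE :=
  LinearMap.mkContinuous
    { toFun := fun y => ⟨fun x => ∫ t in (0:ℝ)..x, f t * cext y t, VVcont f hf y⟩
      map_add' := by
        intro y z
        ext x
        simp only [ContinuousMap.coe_mk, ContinuousMap.add_apply]
        rw [← intervalIntegral.integral_add (ii_sub (ii_mul hf (cext_cont y).continuousOn) x.2)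
          (ii_sub (ii_mul hf (cext_cont z).continuousOn) x.2)]
        congr 1; ext t; simp [cext, IccExtend]; ring
      map_smul' := by
        intro c y
        ext x
        simp only [ContinuousMap.coe_mk, ContinuousMap.smul_apply, smul_eq_mul, RingHom.id_apply]
        rw [← intervalIntegral.integral_const_mul]
        congr 1; ext t; simp [cext, IccExtend]; ring }
    (∫ t in (0:ℝ)..π, ‖f t‖) (by
      intro y
      rw [ContinuousMap.norm_le _ (by
        apply mul_nonneg _ (norm_nonneg _)
        exact intervalIntegral.integral_nonneg Real.pi_pos.le (fun _ _ => norm_nonneg _))]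
      intro x
      simp only [LinearMap.coe_mk, AddHom.coe_mk, ContinuousMap.coe_mk]
      have i1 := ii_sub (ii_mul hf (cext_cont y).continuousOn) x.2
      calc ‖∫ t in (0:ℝ)..x, f t * cext y t‖ ≤ ∫ t in (0:ℝ)..x, ‖f t * cext y t‖ :=
            intervalIntegral.norm_integral_le_integral_norm x.2.1
        _ ≤ ∫ t in (0:ℝ)..x, ‖f t‖ * ‖y‖ := by
            apply intervalIntegral.integral_mono_on x.2.1 i1.norm ((ii_sub hf x.2).norm.mul_const _)
            intro t _
            rw [norm_mul]
            exact mul_le_mul_of_nonneg_left (cext_norm y t) (norm_nonneg _)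
        _ = (∫ t in (0:ℝ)..x, ‖f t‖) * ‖y‖ := by rw [intervalIntegral.integral_mul_const]
        _ ≤ _ := by
            apply mul_le_mul_of_nonneg_right _ (norm_nonneg _)
            exact intervalIntegral.integral_mono_interval le_rfl x.2.1 x.2.2
              (Filter.Eventually.of_forall fun _ => norm_nonneg _) hf.norm)

theorem VV_apply (f : ℝ → ℂ) (hf : IntervalIntegrable f volume 0 π) (y : CE) {x : ℝ}
    (hx : x ∈ Icc (0:ℝ) π) : VV f hf y ⟨x, hx⟩ = ∫ t in (0:ℝ)..x, f t * cext y t := rfl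

theorem VV_apply' (f : ℝ → ℂ) (hf : IntervalIntegrable f volume 0 π) (y : CE) {g : ℝ → ℂ}
    (hg : ∀ (t) (ht : t ∈ Icc (0:ℝ) π), y ⟨t, ht⟩ = g t) {x : ℝ}
    (hx : x ∈ Icc (0:ℝ) π) : VV f hf y ⟨x, hx⟩ = ∫ t in (0:ℝ)..x, f t * g t := by
  rw [VV_apply]
  apply intervalIntegral.integral_congr
  intro t ht
  rw [uIcc_of_le hx.1] at ht
  have ht' : t ∈ Icc (0:ℝ) π := ⟨ht.1, ht.2.trans hx.2⟩
  simp only []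
  rw [cext_apply y ht', hg t ht']

theorem ii_one : IntervalIntegrable (fun _ : ℝ => (1:ℂ)) volume 0 π := intervalIntegrable_const

/-- one step bound -/
theorem VV_step (f : ℝ → ℂ) (hf : IntervalIntegrable f volume 0 π) {κ : ℝ} (hκ : 0 < κ)
    {c : ℝ} (hc : 0 ≤ c) (y : CE) (hy : ∀ x : Icc (0:ℝ) π, ‖y x‖ ≤ c * rexp (κ * x)) :
    ∀ x : Icc (0:ℝ) π, ‖(VV _ ii_one (VV f hf y)) x‖ ≤
      c * ((∫ t in (0:ℝ)..π, ‖f t‖) / κ) * rexp (κ * x) := by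
  set Q := ∫ t in (0:ℝ)..π, ‖f t‖ with hQ
  have hQ0 : 0 ≤ Q := intervalIntegral.integral_nonneg Real.pi_pos.le (fun _ _ => norm_nonneg _)
  have h1 : ∀ x : Icc (0:ℝ) π, ‖(VV f hf y) x‖ ≤ c * Q * rexp (κ * x) := by
    intro x
    have i1 := ii_sub (ii_mul hf (cext_cont y).continuousOn) x.2
    rw [VV_apply f hf y x.2]
    calc ‖∫ t in (0:ℝ)..x, f t * cext y t‖ ≤ ∫ t in (0:ℝ)..x, ‖f t * cext y t‖ :=
            intervalIntegral.norm_integral_le_integral_norm x.2.1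
      _ ≤ ∫ t in (0:ℝ)..x, ‖f t‖ * (c * rexp (κ * x)) := by
            apply intervalIntegral.integral_mono_on x.2.1 i1.norm ((ii_sub hf x.2).norm.mul_const _)
            intro t ht
            rw [norm_mul]
            refine mul_le_mul_of_nonneg_left ?_ (norm_nonneg _)
            have ht' : t ∈ Icc (0:ℝ) π := ⟨ht.1, ht.2.trans x.2.2⟩
            rw [cext_apply y ht']
            refine (hy ⟨t, ht'⟩).trans ?_
            have : t ≤ x := ht.2
            gcongr
      _ = (∫ t in (0:ℝ)..x, ‖f t‖) * (c * rexp (κ * x)) := by rw [intervalIntegral.integral_mul_const]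
      _ ≤ Q * (c * rexp (κ * x)) := by
            apply mul_le_mul_of_nonneg_right _ (by positivity)
            exact intervalIntegral.integral_mono_interval le_rfl x.2.1 x.2.2
              (Filter.Eventually.of_forall fun _ => norm_nonneg _) hf.norm
      _ = _ := by ring
  intro x
  rw [VV_apply _ _ _ x.2]
  have i1 := ii_sub (ii_mul ii_one (cext_cont (VV f hf y)).continuousOn) x.2
  calc ‖∫ t in (0:ℝ)..x, 1 * cext (VV f hf y) t‖ ≤ ∫ t in (0:ℝ)..x, ‖1 * cext (VV f hf y) t‖ :=
            intervalIntegral.norm_integral_le_integral_norm x.2.1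
    _ ≤ ∫ t in (0:ℝ)..x, c * Q * rexp (κ * t) := by
            apply intervalIntegral.integral_mono_on x.2.1 i1.norm
              (Continuous.intervalIntegrable (by fun_prop) _ _)
            intro t ht
            have ht' : t ∈ Icc (0:ℝ) π := ⟨ht.1, ht.2.trans x.2.2⟩
            rw [one_mul, cext_apply _ ht']
            exact h1 ⟨t, ht'⟩
    _ = c * Q * ((rexp (κ * x) - 1) / κ) := by
            rw [intervalIntegral.integral_const_mul]
            congr 1
            have : ∀ t ∈ uIcc (0:ℝ) x, HasDerivAt (fun t => rexp (κ * t) / κ) (rexp (κ * t)) t := by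
              intro t _
              have := (((hasDerivAt_id t).const_mul κ).exp).div_const κ
              exact this.congr_deriv (by simp only [id]; field_simp)
            rw [intervalIntegral.integral_eq_sub_of_hasDerivAt this
              (Continuous.intervalIntegrable (by fun_prop) _ _)]
            simp; ring
    _ ≤ c * Q * (rexp (κ * x) / κ) := by gcongr; linarith
    _ = _ := by ring

theorem unit_aux {R : Type*} [NormedRing R] [CompleteSpace R] (K : R) (n : ℕ) (h : ‖K ^ n‖ < 1) :
    IsUnit (1 - K) := by
  have hu := isUnit_one_sub_of_norm_lt_one h
  rw [← mul_neg_geom_sum] at hu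
  have hcomm : Commute (1 - K) (∑ i ∈ Finset.range n, K^i) := by
    apply Commute.sum_right
    intro i _
    exact ((Commute.one_left _).sub_left ((Commute.refl K).pow_right i))
  exact (hcomm.isUnit_mul_iff.1 hu).1

theorem VV_unit (f : ℝ → ℂ) (hf : IntervalIntegrable f volume 0 π) :
    IsUnit (1 - (VV _ ii_one) * (VV f hf)) := by
  set K := (VV _ ii_one) * (VV f hf) with hK
  set Q := ∫ t in (0:ℝ)..π, ‖f t‖ with hQ
  have hQ0 : 0 ≤ Q := intervalIntegral.integral_nonneg Real.pi_pos.le (fun _ _ => norm_nonneg _)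
  set κ := 2 * (Q + 1) with hκ
  have hκ0 : 0 < κ := by positivity
  have hr : Q / κ ≤ 1/2 := by rw [div_le_iff₀ hκ0]; linarith
  have key : ∀ (n : ℕ) (y : CE) (x : Icc (0:ℝ) π), ‖((K ^ n) y) x‖ ≤ ‖y‖ * (Q/κ)^n * rexp (κ * x) := by
    intro n
    induction n with
    | zero =>
      intro y x
      have : (1:ℝ) ≤ rexp (κ * x) := Real.one_le_exp (mul_nonneg hκ0.le x.2.1)
      simp only [pow_zero, mul_one, one_apply_eq_self]
      exact (y.norm_coe_le_norm x).trans (le_mul_of_one_le_right (norm_nonneg _) this)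
    | succ n ih =>
      intro y x
      have := VV_step f hf hκ0 (c := ‖y‖ * (Q/κ)^n) (by positivity) ((K^n) y) (ih y) x
      rw [pow_succ' K]
      refine this.trans (le_of_eq ?_)
      rw [← hQ]; ring
  obtain ⟨n, hn⟩ : ∃ n : ℕ, (Q/κ)^n * rexp (κ * π) < 1 := by
    have h1 : Filter.Tendsto (fun n : ℕ => (Q/κ)^n * rexp (κ * π)) Filter.atTop (nhds (0 * rexp (κ * π))) :=
      (tendsto_pow_atTop_nhds_zero_of_lt_one (by positivity) (by linarith)).mul_const _
    rw [zero_mul] at h1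
    exact (h1.eventually (gt_mem_nhds one_pos)).exists
  have hnorm : ‖K^n‖ < 1 := by
    refine lt_of_le_of_lt (ContinuousLinearMap.opNorm_le_bound _ (by positivity) ?_) hn
    intro y
    rw [ContinuousMap.norm_le _ (by positivity)]
    intro x
    refine (key n y x).trans ?_
    have : (x:ℝ) ≤ π := x.2.2
    calc _ ≤ ‖y‖ * (Q/κ)^n * rexp (κ * π) := by gcongr
      _ = _ := by ring
  exact unit_aux (R := CE →L[ℂ] CE) K n hnorm


/-- complex solutions -/
def CSol (q : ℝ → ℝ) (l : ℂ) (y z : ℝ → ℂ) : Prop :=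
  ContinuousOn y (Icc 0 π) ∧ ContinuousOn z (Icc 0 π) ∧
  (∀ x ∈ Icc (0:ℝ) π, y x = y 0 + ∫ t in (0:ℝ)..x, z t) ∧
  (∀ x ∈ Icc (0:ℝ) π, z x = z 0 + ∫ t in (0:ℝ)..x, ((q t : ℂ) - l) * y t)

abbrev QI (q : ℝ → ℝ) : Prop := IntervalIntegrable (fun t => (q t : ℂ)) volume 0 π

theorem QI.sub {q : ℝ → ℝ} (hq : QI q) (l : ℂ) :
    IntervalIntegrable (fun t => (q t : ℂ) - l) volume 0 π :=
  IntervalIntegrable.sub hq intervalIntegrable_const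

theorem mem0 : (0:ℝ) ∈ Icc (0:ℝ) π := ⟨le_rfl, Real.pi_pos.le⟩
theorem memπ : π ∈ Icc (0:ℝ) π := ⟨Real.pi_pos.le, le_rfl⟩

theorem VV_sub {q : ℝ → ℝ} (hq : QI q) (l : ℂ) :
    VV _ (hq.sub l) = VV _ hq - l • VV _ ii_one := by
  ext y x
  simp only [sub_apply, smul_apply, ContinuousMap.sub_apply,
    ContinuousMap.smul_apply, smul_eq_mul]
  rw [VV_apply _ _ _ x.2, VV_apply _ _ _ x.2, VV_apply _ _ _ x.2,
    ← intervalIntegral.integral_const_mul, ← intervalIntegral.integral_sub]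
  · congr 1; ext t; ring
  · exact ii_sub (ii_mul hq (cext_cont y).continuousOn) x.2
  · exact (ii_sub (ii_mul ii_one (cext_cont y).continuousOn) x.2).const_mul l

theorem csol_unique {q : ℝ → ℝ} (hq : QI q) {l : ℂ} {y z u v : ℝ → ℂ}
    (h1 : CSol q l y z) (h2 : CSol q l u v) (h0 : y 0 = u 0) (h0' : z 0 = v 0) :
    ∀ x ∈ Icc (0:ℝ) π, y x = u x ∧ z x = v x := by
  obtain ⟨cy, cz, ey, ez⟩ := h1
  obtain ⟨cu, cv, eu, ev⟩ := h2
  set D : CE := ⟨fun x => y x - u x, (cy.sub cu).domRestrict⟩ with hD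
  have sz : ∀ x ∈ Icc (0:ℝ) π, z x - v x = ∫ t in (0:ℝ)..x, ((q t : ℂ) - l) * (y t - u t) := by
    intro x hx
    rw [ez x hx, ev x hx, h0', add_sub_add_left_eq_sub, ← intervalIntegral.integral_sub]
    · congr 1; ext t; ring
    · exact ii_sub (ii_mul (hq.sub l) cy) hx
    · exact ii_sub (ii_mul (hq.sub l) cu) hx
  have sy : ∀ x ∈ Icc (0:ℝ) π, y x - u x = ∫ t in (0:ℝ)..x, 1 * (z t - v t) := by
    intro x hx
    rw [ey x hx, eu x hx, h0, add_sub_add_left_eq_sub, ← intervalIntegral.integral_sub]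
    · congr 1; ext t; ring
    · simpa using ii_sub (ii_mul ii_one cz) hx
    · simpa using ii_sub (ii_mul ii_one cv) hx
  have hDf : D = (VV _ ii_one) (VV _ (hq.sub l) D) := by
    ext x
    rw [VV_apply' _ _ _ (g := fun t => z t - v t) _ x.2]
    · exact sy x x.2
    · intro t ht
      rw [VV_apply' _ _ _ (g := fun t => y t - u t) _ ht]
      · exact (sz t ht).symm
      · intro _ _; rfl
  have hD0 : D = 0 := by
    obtain ⟨U, hU⟩ := VV_unit _ (hq.sub l)
    have e1 : (1 - (VV _ ii_one) * (VV _ (hq.sub l))) D = 0 := by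
      simp only [sub_apply, one_apply_eq_self]
      exact sub_eq_zero.2 hDf
    have : (↑U⁻¹ * (U : CE →L[ℂ] CE)) D = 0 := by
      rw [hU]
      show (↑U⁻¹ : CE →L[ℂ] CE) ((1 - (VV _ ii_one) * (VV _ (hq.sub l))) D) = 0
      rw [e1, map_zero]
    rw [Units.inv_mul] at this
    simpa using this
  have hd : ∀ x ∈ Icc (0:ℝ) π, y x = u x := by
    intro x hx
    have : D ⟨x, hx⟩ = 0 := by rw [hD0]; rfl
    exact sub_eq_zero.1 this
  intro x hx
  refine ⟨hd x hx, ?_⟩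
  rw [← sub_eq_zero, sz x hx]
  rw [show (0:ℂ) = ∫ t in (0:ℝ)..x, (0:ℂ) by simp]
  apply intervalIntegral.integral_congr
  intro t ht
  rw [uIcc_of_le hx.1] at ht
  simp only []
  rw [hd t ⟨ht.1, ht.2.trans hx.2⟩]; ring

theorem inv_diff {R : Type*} [NormedRing R] [NormedAlgebra ℂ R] [CompleteSpace R] (A B : R)
    (h : ∀ l : ℂ, IsUnit (1 - A * (B - l • A))) :
    Differentiable ℂ (fun l : ℂ => Ring.inverse (1 - A * (B - l • A))) := by
  intro l
  have hd : DifferentiableAt ℂ (fun l : ℂ => 1 - A * (B - l • A)) l := by fun_prop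
  exact (differentiableAt_inverse (𝕜 := ℂ) (h l)).comp l hd

theorem csol_exists {q : ℝ → ℝ} (hq : QI q) (a b : ℂ) :
    ∃ (Y : ℂ → CE) (y z : ℂ → ℝ → ℂ), Differentiable ℂ Y ∧
      (∀ l, CSol q l (y l) (z l)) ∧ (∀ l, y l 0 = a) ∧ (∀ l, z l 0 = b) ∧
      (∀ l x hx, Y l ⟨x, hx⟩ = y l x) ∧
      Differentiable ℂ (fun l => y l π) ∧ Differentiable ℂ (fun l => z l π) := by
  set c : CE := ⟨fun x => a + b * (x:ℝ), by fun_prop⟩ with hc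
  set K : ℂ → (CE →L[ℂ] CE) := fun l => 1 - (VV _ ii_one) * (VV _ hq - l • VV _ ii_one) with hK
  have hKu : ∀ l, IsUnit (K l) := by
    intro l
    have := VV_unit _ (hq.sub l)
    rwa [VV_sub] at this
  set Y : ℂ → CE := fun l => (Ring.inverse (K l)) c with hY
  have hYd : Differentiable ℂ Y := by
    intro l
    have h1 : DifferentiableAt ℂ (fun l => Ring.inverse (K l)) l :=
      inv_diff (R := CE →L[ℂ] CE) _ _ hKu l
    exact h1.clm_apply (differentiableAt_const _)
  have hYeq : ∀ l, Y l = c + (VV _ ii_one) (VV _ (hq.sub l) (Y l)) := by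
    intro l
    have : (K l * Ring.inverse (K l)) c = c := by
      rw [Ring.mul_inverse_cancel _ (hKu l)]; rfl
    have h2 : K l (Y l) = c := this
    simp only [hK] at h2
    rw [← VV_sub, sub_apply] at h2
    exact sub_eq_iff_eq_add.1 h2
  set y : ℂ → ℝ → ℂ := fun l => cext (Y l) with hy
  set z : ℂ → ℝ → ℂ := fun l x => b + cext (VV _ (hq.sub l) (Y l)) x with hz
  have hyY : ∀ l x hx, Y l ⟨x, hx⟩ = y l x := fun l x hx => (cext_apply _ hx).symm
  have hy0 : ∀ l, y l 0 = a := by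
    intro l
    simp only [hy]
    rw [cext_apply _ mem0, hYeq l, ContinuousMap.add_apply, VV_apply]
    simp [hc]
  have hz0 : ∀ l, z l 0 = b := by
    intro l
    simp only [hz]
    rw [cext_apply _ mem0, VV_apply]
    simp
  have ev : ∀ x (hx : x ∈ Icc (0:ℝ) π), Differentiable ℂ (fun l => Y l ⟨x, hx⟩) := by
    intro x hx
    exact ((ContinuousMap.evalCLM ℂ (⟨x, hx⟩ : Icc (0:ℝ) π)).differentiable).comp hYd
  refine ⟨Y, y, z, hYd, ?_, hy0, hz0, hyY, ?_, ?_⟩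
  · intro l
    refine ⟨(cext_cont _).continuousOn, (continuous_const.add (cext_cont _)).continuousOn, ?_, ?_⟩
    · intro x hx
      rw [hy0]
      simp only [hy, hz]
      rw [cext_apply _ hx, hYeq l, ContinuousMap.add_apply, VV_apply, intervalIntegral.integral_add
        (by simp) ((cext_cont _).intervalIntegrable _ _), ← hYeq l]
      simp [hc]; ring
    · intro x hx
      rw [hz0]
      simp only [hy, hz]
      rw [cext_apply _ hx, VV_apply]
  · intro l
    have := ev π memπ l
    simpa only [hyY] using this
  · have : (fun l => z l π) = fun l => b +
        (ContinuousMap.evalCLM ℂ (⟨π, memπ⟩ : Icc (0:ℝ) π)) ((VV _ hq - l • VV _ ii_one) (Y l)) := by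
      ext l
      simp only [hz]
      rw [cext_apply _ memπ, ← VV_sub]; rfl
    rw [this]
    intro l
    refine (differentiableAt_const _).add ?_
    refine (ContinuousLinearMap.differentiable _).differentiableAt.comp l ?_
    exact DifferentiableAt.clm_apply ((differentiableAt_const _).sub (differentiableAt_id.smul_const _)) (hYd l)


theorem ii_cont {g : ℝ → ℂ} (hg : ContinuousOn g (Icc 0 π)) : IntervalIntegrable g volume 0 π := by
  apply ContinuousOn.intervalIntegrable
  rwa [uIcc_of_le Real.pi_pos.le]

theorem lagrange {q : ℝ → ℝ} (hq : QI q) {l m : ℂ} {y z u v : ℝ → ℂ}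
    (h1 : CSol q l y z) (h2 : CSol q m u v) :
    y π * v π - z π * u π = y 0 * v 0 - z 0 * u 0 + (l - m) * ∫ t in (0:ℝ)..π, y t * u t := by
  obtain ⟨cy, cz, ey, ez⟩ := h1
  obtain ⟨cu, cv, eu, ev⟩ := h2
  have i1 := ii_mul (hq.sub l) cy
  have i2 := ii_mul (hq.sub m) cu
  have a1 := prim_mul (ii_cont cz) i2 ey ev π memπ
  have a2 := prim_mul i1 (ii_cont cv) ez eu π memπ
  rw [a1, a2, add_sub_add_comm, ← intervalIntegral.integral_sub, ← intervalIntegral.integral_const_mul]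
  · congr 2
    ext t; ring
  · exact (ii_cont (cz.mul cv)).add (by
      have := ii_mul i2 cy
      refine this.congr_ae (Filter.Eventually.of_forall fun t => ?_)
      simp only []; ring)
  · exact (ii_mul i1 cu).add (ii_cont (cz.mul cv))

theorem iconj (f : ℝ → ℂ) {x : ℝ} (hx : 0 ≤ x) :
    (starRingEnd ℂ) (∫ t in (0:ℝ)..x, f t) = ∫ t in (0:ℝ)..x, (starRingEnd ℂ) (f t) := by
  rw [intervalIntegral.integral_of_le hx, intervalIntegral.integral_of_le hx, integral_conj]

theorem csol_conj {q : ℝ → ℝ} {l : ℂ} {y z : ℝ → ℂ} (h : CSol q l y z) :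
    CSol q ((starRingEnd ℂ) l) (fun x => (starRingEnd ℂ) (y x)) (fun x => (starRingEnd ℂ) (z x)) := by
  obtain ⟨cy, cz, ey, ez⟩ := h
  refine ⟨Complex.continuous_conj.comp_continuousOn cy, Complex.continuous_conj.comp_continuousOn cz, ?_, ?_⟩
  · intro x hx
    beta_reduce; rw [ey x hx, map_add, iconj _ hx.1]
  · intro x hx
    beta_reduce; rw [ez x hx, map_add, iconj _ hx.1]
    simp

theorem posint {y : ℝ → ℂ} (hy : ContinuousOn y (Icc 0 π)) (h0 : y 0 ≠ 0) :
    ∫ t in (0:ℝ)..π, y t * (starRingEnd ℂ) (y t) ≠ 0 := by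
  have : ∫ t in (0:ℝ)..π, y t * (starRingEnd ℂ) (y t) = ((∫ t in (0:ℝ)..π, ‖y t‖^2 : ℝ) : ℂ) := by
    rw [← intervalIntegral.integral_ofReal]
    congr 1; ext t
    rw [Complex.mul_conj']; simp
  rw [this]
  have hp : 0 < ∫ t in (0:ℝ)..π, ‖y t‖^2 := by
    apply intervalIntegral.integral_pos Real.pi_pos (hy.norm.pow 2) (fun _ _ => sq_nonneg _)
    exact ⟨0, mem0, pow_pos (norm_pos_iff.2 h0) 2⟩
  exact_mod_cast hp.ne'

theorem csol_real {q : ℝ → ℝ} (hq : QI q) {l : ℂ} {y z : ℝ → ℂ} (h : CSol q l y z) {a b c d : ℝ}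
    (ha : y 0 = a) (hb : z 0 = b) (ha0 : a ≠ 0) (hcd : c^2 + d^2 = 1)
    (hΦ : y π * c + z π * d = 0) : l.im = 0 := by
  have L := lagrange hq h (csol_conj h)
  have hΦ' : (starRingEnd ℂ) (y π) * c + (starRingEnd ℂ) (z π) * d = 0 := by
    have := congrArg (starRingEnd ℂ) hΦ
    simpa using this
  simp only [ha, hb, Complex.conj_ofReal] at L
  have hcd' : (c:ℂ)^2 + (d:ℂ)^2 = 1 := by exact_mod_cast hcd
  have e : y π * (starRingEnd ℂ) (z π) - z π * (starRingEnd ℂ) (y π) = 0 := by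
    generalize (starRingEnd ℂ) (z π) = Z at *
    generalize (starRingEnd ℂ) (y π) = W at *
    linear_combination (exp := 1) (-(y π * Z - z π * W)) * hcd' + (c * Z - d * W) * hΦ - (c * z π - d * y π) * hΦ'
  rw [e] at L
  have L2 : (l - (starRingEnd ℂ) l) * ∫ t in (0:ℝ)..π, y t * (starRingEnd ℂ) (y t) = 0 := by
    rw [show (a:ℂ) * b - b * a = 0 by ring, zero_add] at L
    exact L.symm
  rcases mul_eq_zero.1 L2 with h3 | h3
  · have := Complex.conj_eq_iff_im.1 (sub_eq_zero.1 h3).symm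
    exact this
  · exact absurd h3 (posint h.1 (by rw [ha]; exact_mod_cast ha0))

theorem csol_exp {q : ℝ → ℝ} (hq : QI q) {l : ℂ} {y z : ℝ → ℂ} (h : CSol q l y z) {σ : ℂ}
    (hσ : σ ^ 2 = l) : ∀ x ∈ Icc (0:ℝ) π,
    Complex.exp (-(Complex.I * σ * x)) * (z x + Complex.I * σ * y x) =
      (z 0 + Complex.I * σ * y 0) + ∫ t in (0:ℝ)..x, Complex.exp (-(Complex.I * σ * t)) * ((q t : ℂ) * y t) := by
  obtain ⟨cy, cz, ey, ez⟩ := h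
  have iq := ii_mul hq cy
  have i1 := ii_mul (hq.sub l) cy
  have i2 : IntervalIntegrable (fun t => ((q t : ℂ) - l) * y t + Complex.I * σ * z t) volume 0 π :=
    i1.add ((ii_cont cz).const_mul _)
  have hE : ∀ x ∈ Icc (0:ℝ) π, (fun x : ℝ => Complex.exp (-(Complex.I * σ * x))) x =
      (fun x : ℝ => Complex.exp (-(Complex.I * σ * x))) 0 +
        ∫ t in (0:ℝ)..x, -(Complex.I * σ) * Complex.exp (-(Complex.I * σ * t)) := by
    intro x _
    have hd : ∀ t ∈ uIcc (0:ℝ) x, HasDerivAt (fun x : ℝ => Complex.exp (-(Complex.I * σ * x)))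
        (-(Complex.I * σ) * Complex.exp (-(Complex.I * σ * t))) t := by
      intro t _
      have h1 : HasDerivAt (fun x : ℝ => -(Complex.I * σ * x)) (-(Complex.I * σ * 1)) t :=
        ((Complex.ofRealCLM.hasDerivAt (x := t)).const_mul (Complex.I * σ)).neg
      exact h1.cexp.congr_deriv (by ring)
    rw [intervalIntegral.integral_eq_sub_of_hasDerivAt hd
      (Continuous.intervalIntegrable (by fun_prop) _ _)]
    ring
  have hp : ∀ x ∈ Icc (0:ℝ) π, (fun x => z x + Complex.I * σ * y x) x =
      (fun x => z x + Complex.I * σ * y x) 0 +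
        ∫ t in (0:ℝ)..x, (((q t : ℂ) - l) * y t + Complex.I * σ * z t) := by
    intro x hx
    simp only []
    rw [intervalIntegral.integral_add (ii_sub i1 hx) ((ii_sub (ii_cont cz) hx).const_mul _),
      intervalIntegral.integral_const_mul, ez x hx, ey x hx]
    ring
  intro x hx
  have := prim_mul (Continuous.intervalIntegrable (by fun_prop) _ _) i2 hE hp x hx
  beta_reduce at this
  rw [this]
  simp only [Complex.ofReal_zero, mul_zero, neg_zero, Complex.exp_zero, one_mul]
  congr 2
  ext t
  rw [← hσ]
  have hI := Complex.I_sq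
  linear_combination (-Complex.exp (-(Complex.I * σ * t)) * σ^2 * y t) * hI

theorem csol_pbound {q : ℝ → ℝ} (hq : QI q) {l : ℂ} {y z : ℝ → ℂ} (h : CSol q l y z) {σ : ℂ}
    (hσ : σ ^ 2 = l) {τ M : ℝ} (hτ : |σ.im| ≤ τ) (hM : ∀ x ∈ Icc (0:ℝ) π, ‖y x‖ ≤ M * rexp (τ * x))
    (hM0 : 0 ≤ M) : ∀ x ∈ Icc (0:ℝ) π,
    ‖(z x + Complex.I * σ * y x) - Complex.exp (Complex.I * σ * x) * (z 0 + Complex.I * σ * y 0)‖ ≤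
      rexp (τ * x) * (M * ∫ t in (0:ℝ)..π, ‖(q t : ℂ)‖) := by
  intro x hx
  have e := csol_exp hq h hσ x hx
  have e2 : (z x + Complex.I * σ * y x) - Complex.exp (Complex.I * σ * x) * (z 0 + Complex.I * σ * y 0)
      = ∫ t in (0:ℝ)..x, Complex.exp (Complex.I * σ * (x - t)) * ((q t : ℂ) * y t) := by
    have : ∀ t : ℝ, Complex.exp (Complex.I * σ * (x - t)) * ((q t : ℂ) * y t) =
        Complex.exp (Complex.I * σ * x) * (Complex.exp (-(Complex.I * σ * t)) * ((q t : ℂ) * y t)) := by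
      intro t; rw [show Complex.I * σ * (x - t) = Complex.I * σ * x + -(Complex.I * σ * t) by ring, Complex.exp_add]; ring
    simp_rw [this]
    rw [intervalIntegral.integral_const_mul]
    have h3 : Complex.exp (Complex.I * σ * x) * Complex.exp (-(Complex.I * σ * x)) = 1 := by
      rw [← Complex.exp_add]; simp
    linear_combination (Complex.exp (Complex.I * σ * x)) * e - (z x + Complex.I * σ * y x) * h3
  rw [e2]
  have iq := ii_sub (ii_mul hq h.1) hx
  have i1 : IntervalIntegrable (fun t : ℝ => Complex.exp (Complex.I * σ * (x - t)) * ((q t : ℂ) * y t)) volume 0 x :=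
    iq.continuousOn_mul (Continuous.continuousOn (by fun_prop))
  calc _ ≤ ∫ t in (0:ℝ)..x, ‖Complex.exp (Complex.I * σ * (x - t)) * ((q t : ℂ) * y t)‖ :=
        intervalIntegral.norm_integral_le_integral_norm hx.1
    _ ≤ ∫ t in (0:ℝ)..x, rexp (τ * x) * M * ‖(q t : ℂ)‖ := by
        apply intervalIntegral.integral_mono_on hx.1 i1.norm ((ii_sub hq hx).norm.const_mul _)
        intro t ht
        have ht' : t ∈ Icc (0:ℝ) π := ⟨ht.1, ht.2.trans hx.2⟩
        rw [norm_mul, norm_mul, Complex.norm_exp]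
        have hre : (Complex.I * σ * (x - t)).re ≤ τ * (x - t) := by
          have : (Complex.I * σ * (x - t)).re = -σ.im * (x - t) := by simp
          rw [this]
          apply mul_le_mul_of_nonneg_right _ (by linarith [ht.2])
          exact (neg_le_abs _).trans hτ
        calc _ ≤ rexp (τ * (x - t)) * (‖(q t : ℂ)‖ * (M * rexp (τ * t))) := by
              gcongr
              exact hM t ht'
          _ = (rexp (τ * (x - t)) * rexp (τ * t)) * M * ‖(q t : ℂ)‖ := by ring
          _ = _ := by rw [← Real.exp_add]; ring_nf
    _ = rexp (τ * x) * M * ∫ t in (0:ℝ)..x, ‖(q t : ℂ)‖ := by rw [intervalIntegral.integral_const_mul]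
    _ ≤ rexp (τ * x) * M * ∫ t in (0:ℝ)..π, ‖(q t : ℂ)‖ := by
        apply mul_le_mul_of_nonneg_left _ (by positivity)
        exact intervalIntegral.integral_mono_interval le_rfl hx.1 hx.2
              (Filter.Eventually.of_forall fun _ => norm_nonneg _) hq.norm
    _ = _ := by ring

theorem csol_asymp {q : ℝ → ℝ} (hq : QI q) (a b : ℂ) : ∃ C S : ℝ, 0 ≤ C ∧ 1 ≤ S ∧ ∀ (s : ℂ) (y z : ℝ → ℂ),
    S ≤ ‖s‖ → CSol q (s^2) y z → y 0 = a → z 0 = b →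
    ‖y π‖ ≤ C * rexp (π * |s.im|) ∧
    ‖z π + s * a * Complex.sin (π * s)‖ ≤ C * rexp (π * |s.im|) := by
  set Q := ∫ t in (0:ℝ)..π, ‖(q t : ℂ)‖ with hQ
  have hQ0 : 0 ≤ Q := intervalIntegral.integral_nonneg Real.pi_pos.le (fun _ _ => norm_nonneg _)
  set B := 2 * (‖a‖ + ‖b‖) with hB
  have hB0 : 0 ≤ B := by positivity
  refine ⟨B * Q + ‖b‖ + B, 2 * Q + 1, by positivity, by linarith, ?_⟩
  intro s y z hs h ha hb
  set τ := |s.im| with hτ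
  have hτ0 : 0 ≤ τ := abs_nonneg _
  have hs0 : 0 < ‖s‖ := by linarith
  obtain ⟨x0, hx0, hmax⟩ := isCompact_Icc.exists_isMaxOn (⟨0, mem0⟩ : (Icc (0:ℝ) π).Nonempty)
    (f := fun x => ‖y x‖ * rexp (-(τ * x))) (h.1.norm.mul (Continuous.continuousOn (by fun_prop)))
  set M := ‖y x0‖ * rexp (-(τ * x0)) with hM
  have hM0 : 0 ≤ M := by positivity
  have ee : ∀ x : ℝ, rexp (-(τ * x)) * rexp (τ * x) = 1 := fun x => by rw [← Real.exp_add]; simp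
  have hMb : ∀ x ∈ Icc (0:ℝ) π, ‖y x‖ ≤ M * rexp (τ * x) := by
    intro x hx
    have : ‖y x‖ * rexp (-(τ * x)) ≤ M := hmax hx
    calc ‖y x‖ = ‖y x‖ * rexp (-(τ * x)) * rexp (τ * x) := by rw [mul_assoc, ee, mul_one]
      _ ≤ _ := by gcongr
  have P := csol_pbound hq h rfl (le_refl τ) hMb hM0
  have N := csol_pbound hq h (σ := -s) (by ring) (τ := τ) (by simp [hτ]) hMb hM0
  have nexp : ∀ σ : ℂ, |σ.im| = τ → ∀ x ∈ Icc (0:ℝ) π, ‖Complex.exp (Complex.I * σ * x)‖ ≤ rexp (τ * x) := by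
    intro σ hσ x hx
    rw [Complex.norm_exp]
    apply Real.exp_le_exp.2
    have : (Complex.I * σ * x).re = -σ.im * x := by simp
    rw [this]
    exact mul_le_mul_of_nonneg_right ((neg_le_abs _).trans hσ.le) hx.1
  have n1 := nexp s rfl
  have n2 := nexp (-s) (by simp [hτ])
  have hMB : M ≤ B := by
    have p1 := P x0 hx0
    have p2 := N x0 hx0
    have b1 : ‖z 0 + Complex.I * s * y 0‖ ≤ ‖b‖ + ‖s‖ * ‖a‖ := by
      rw [ha, hb]; exact (norm_add_le _ _).trans (by simp)
    have b2 : ‖z 0 + Complex.I * (-s) * y 0‖ ≤ ‖b‖ + ‖s‖ * ‖a‖ := by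
      rw [ha, hb]; exact (norm_add_le _ _).trans (by simp)
    have key : 2 * ‖s‖ * ‖y x0‖ ≤ 2 * rexp (τ * x0) * (M * Q) + 2 * rexp (τ * x0) * (‖b‖ + ‖s‖ * ‖a‖) := by
      have e1 : 2 * Complex.I * s * y x0 =
        ((z x0 + Complex.I * s * y x0) - Complex.exp (Complex.I * s * x0) * (z 0 + Complex.I * s * y 0))
        - ((z x0 + Complex.I * (-s) * y x0) - Complex.exp (Complex.I * (-s) * x0) * (z 0 + Complex.I * (-s) * y 0))
        + Complex.exp (Complex.I * s * x0) * (z 0 + Complex.I * s * y 0)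
        - Complex.exp (Complex.I * (-s) * x0) * (z 0 + Complex.I * (-s) * y 0) := by ring
      have e2 : ‖2 * Complex.I * s * y x0‖ = 2 * ‖s‖ * ‖y x0‖ := by simp
      rw [← e2, e1]
      refine (norm_sub_le _ _).trans ?_
      refine (add_le_add (norm_add_le _ _) le_rfl).trans ?_
      refine (add_le_add (add_le_add (norm_sub_le _ _) le_rfl) le_rfl).trans ?_
      have c1 : ‖Complex.exp (Complex.I * s * x0) * (z 0 + Complex.I * s * y 0)‖ ≤ rexp (τ * x0) * (‖b‖ + ‖s‖ * ‖a‖) := by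
        rw [norm_mul]; gcongr; exact n1 x0 hx0
      have c2 : ‖Complex.exp (Complex.I * (-s) * x0) * (z 0 + Complex.I * (-s) * y 0)‖ ≤ rexp (τ * x0) * (‖b‖ + ‖s‖ * ‖a‖) := by
        rw [norm_mul]; gcongr; exact n2 x0 hx0
      linarith
    have e3 : ‖y x0‖ = M * rexp (τ * x0) := by
      rw [hM, mul_assoc, ee, mul_one]
    rw [e3] at key
    have hpos := Real.exp_pos (τ * x0)
    have k2 : 2 * ‖s‖ * M ≤ 2 * (M * Q) + 2 * (‖b‖ + ‖s‖ * ‖a‖) := by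
      by_contra hcon
      push Not at hcon
      nlinarith [mul_lt_mul_of_pos_right hcon hpos]
    have k3 : ‖s‖ * M ≤ ‖s‖ * B := by
      rw [hB]
      have : 2 * Q * M ≤ ‖s‖ * M := mul_le_mul_of_nonneg_right (by linarith) hM0
      have : ‖b‖ ≤ ‖s‖ * ‖b‖ := le_mul_of_one_le_left (norm_nonneg _) (by linarith)
      nlinarith
    exact le_of_mul_le_mul_left k3 hs0
  have hexp := Real.exp_pos (π * τ)
  constructor
  · refine (hMb π memπ).trans ?_
    rw [mul_comm τ π]
    gcongr
    have : 0 ≤ B * Q := by positivity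
    linarith [norm_nonneg b]
  · have p1 := P π memπ
    have p2 := N π memπ
    have m1 := n1 π memπ
    have m2 := n2 π memπ
    rw [mul_comm τ π] at p1 p2 m1 m2
    set E1 := Complex.exp (Complex.I * s * (π:ℝ)) with hE1
    set E2 := Complex.exp (Complex.I * (-s) * (π:ℝ)) with hE2
    have hsin : Complex.sin (π * s) = (E2 - E1) * Complex.I / 2 := by
      rw [Complex.sin, hE1, hE2]
      congr 4 <;> ring_nf
    have e1 : z π + s * a * Complex.sin (π * s) = (1/2) * ((z π + Complex.I * s * y π) - E1 * (z 0 + Complex.I * s * y 0))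
       + (1/2) * ((z π + Complex.I * (-s) * y π) - E2 * (z 0 + Complex.I * (-s) * y 0)) + (1/2) * (E1 * b) + (1/2) * (E2 * b) := by
      rw [hsin, ha, hb]; ring
    rw [e1]
    refine (norm_add_le _ _).trans ?_
    refine (add_le_add (norm_add_le _ _) le_rfl).trans ?_
    refine (add_le_add (add_le_add (norm_add_le _ _) le_rfl) le_rfl).trans ?_
    have c1 : ‖(1/2:ℂ) * (E1 * b)‖ ≤ 1/2 * (rexp (π * τ) * ‖b‖) := by
      rw [norm_mul, norm_mul]; norm_num; gcongr
    have c2 : ‖(1/2:ℂ) * (E2 * b)‖ ≤ 1/2 * (rexp (π * τ) * ‖b‖) := by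
      rw [norm_mul, norm_mul]; norm_num; gcongr
    have hMQ : rexp (π * τ) * (M * Q) ≤ rexp (π * τ) * (B * Q) := by gcongr
    rw [norm_mul (1/2:ℂ) (_ - _), norm_mul (1/2:ℂ) (_ - _)]
    have hh : ‖(1/2:ℂ)‖ = 1/2 := by norm_num
    rw [hh]
    have : 0 ≤ B * rexp (π * τ) := by positivity
    nlinarith


theorem char_exists {q : ℝ → ℝ} (hq : QI q) {α β : ℝ} (hα : Real.sin α ≠ 0) :
    ∃ F : ℂ → ℂ, Differentiable ℂ F ∧ (∀ l, F l = 0 → l.im = 0) ∧ (∀ l, F l = 0 → deriv F l ≠ 0) ∧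
      (∀ l y z, CSol q l y z → y 0 = (Real.sin α : ℝ) → z 0 = ((-Real.cos α : ℝ) : ℂ) →
        F l = y π * (Real.cos β : ℝ) + z π * (Real.sin β : ℝ)) ∧
      ∃ C S : ℝ, 0 ≤ C ∧ 1 ≤ S ∧ ∀ s : ℂ, S ≤ ‖s‖ →
        ‖F (s^2) + ((Real.sin α * Real.sin β : ℝ) : ℂ) * (s * Complex.sin (π * s))‖ ≤ C * rexp (π * |s.im|) := by
  obtain ⟨Y, y, z, dY, hs, ha, hb, hY, dy, dz⟩ := csol_exists hq ((Real.sin α : ℝ) : ℂ) ((-Real.cos α : ℝ) : ℂ)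
  have hcs : (Real.cos β)^2 + (Real.sin β)^2 = 1 := Real.cos_sq_add_sin_sq β
  have hcs' : ((Real.cos β : ℝ) : ℂ)^2 + ((Real.sin β : ℝ) : ℂ)^2 = 1 := by exact_mod_cast hcs
  have him : ∀ l, y l π * (Real.cos β : ℝ) + z l π * (Real.sin β : ℝ) = 0 → l.im = 0 := fun l hl =>
    csol_real hq (hs l) (ha l) (hb l) hα hcs hl
  have dF : Differentiable ℂ (fun l => y l π * (Real.cos β : ℝ) + z l π * (Real.sin β : ℝ)) :=
    (dy.mul_const _).add (dz.mul_const _)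
  refine ⟨fun l => y l π * (Real.cos β : ℝ) + z l π * (Real.sin β : ℝ), dF, him, ?_, ?_, ?_⟩
  · intro l0 hl0 hder
    beta_reduce at hl0
    have hconj : (starRingEnd ℂ) l0 = l0 := Complex.conj_eq_iff_im.2 (him l0 hl0)
    have hc := csol_conj (hs l0)
    rw [hconj] at hc
    have hreal : ∀ x ∈ Icc (0:ℝ) π, y l0 x = (starRingEnd ℂ) (y l0 x) := fun x hx =>
      (csol_unique hq (hs l0) hc (by rw [ha, Complex.conj_ofReal]) (by rw [hb, Complex.conj_ofReal]) x hx).1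
    set c := y l0 π * (Real.sin β : ℝ) - z l0 π * (Real.cos β : ℝ) with hcdef
    have hu : y l0 π = c * (Real.sin β : ℝ) := by
      rw [hcdef]; linear_combination (-y l0 π) * hcs' + (Real.cos β : ℝ) * hl0
    have hv : z l0 π = - c * (Real.cos β : ℝ) := by
      rw [hcdef]; linear_combination (-z l0 π) * hcs' + (Real.sin β : ℝ) * hl0
    have iu : IntervalIntegrable (y l0) volume 0 π := ii_cont (hs l0).1
    set J : ℂ → ℂ := fun l => VV _ iu (Y l) ⟨π, memπ⟩ with hJ
    have hJe : ∀ l, J l = ∫ t in (0:ℝ)..π, y l0 t * y l t := fun l =>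
      VV_apply' _ iu (Y l) (hY l) memπ
    have dJ : Differentiable ℂ J := by
      have := (ContinuousMap.evalCLM ℂ (⟨π, memπ⟩ : Icc (0:ℝ) π) : CE →L[ℂ] ℂ).differentiable.comp
        ((VV _ iu).differentiable.comp dY)
      exact this
    have hL : (fun l => (l - l0) * J l) = fun l => -c * (y l π * (Real.cos β : ℝ) + z l π * (Real.sin β : ℝ)) := by
      ext l
      have := lagrange hq (hs l) (hs l0)
      rw [ha, hb, ha, hb] at this
      have e : J l = ∫ t in (0:ℝ)..π, y l t * y l0 t := by
        rw [hJe]; congr 1; ext t; ring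
      rw [e]
      rw [hu, hv] at this
      linear_combination -this
    have d1 : HasDerivAt (fun l => (l - l0) * J l) (1 * J l0 + (l0 - l0) * deriv J l0) l0 :=
      ((hasDerivAt_id l0).sub_const l0).mul (dJ l0).hasDerivAt
    have d2 := (dF l0).hasDerivAt.const_mul (-c)
    rw [hL] at d1
    have := d1.unique d2
    rw [hder] at this
    simp only [one_mul, sub_self, zero_mul, add_zero, mul_zero] at this
    rw [hJe] at this
    refine posint (hs l0).1 (by rw [ha]; exact_mod_cast hα) ?_
    rw [← this]
    apply intervalIntegral.integral_congr
    intro t ht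
    rw [uIcc_of_le Real.pi_pos.le] at ht
    beta_reduce
    rw [← hreal t ht]
  · intro l y' z' h h1 h2
    have := csol_unique hq (hs l) h (by rw [ha, h1]) (by rw [hb, h2]) π memπ
    rw [← this.1, ← this.2]
  · obtain ⟨C, S, hC, hS, H⟩ := csol_asymp hq ((Real.sin α : ℝ) : ℂ) ((-Real.cos α : ℝ) : ℂ)
    refine ⟨2 * C, S, by positivity, hS, fun s hsS => ?_⟩
    obtain ⟨h1, h2⟩ := H s _ _ hsS (hs (s^2)) (ha _) (hb _)
    beta_reduce
    have e : y (s^2) π * (Real.cos β : ℝ) + z (s^2) π * (Real.sin β : ℝ) +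
        ((Real.sin α * Real.sin β : ℝ) : ℂ) * (s * Complex.sin (π * s)) =
        y (s^2) π * (Real.cos β : ℝ) + (z (s^2) π + s * (Real.sin α : ℝ) * Complex.sin (π * s)) * (Real.sin β : ℝ) := by
      push_cast; ring
    rw [e]
    refine (norm_add_le _ _).trans ?_
    rw [norm_mul, norm_mul, Complex.norm_real, Complex.norm_real, Real.norm_eq_abs, Real.norm_eq_abs]
    have := Real.abs_cos_le_one β
    have := Real.abs_sin_le_one β
    have t1 := mul_le_mul h1 (Real.abs_cos_le_one β) (abs_nonneg _) (by positivity)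
    have t2 := mul_le_mul h2 (Real.abs_sin_le_one β) (abs_nonneg _) (by positivity)
    linarith


theorem le_of_sq_le_sq_aux {a b : ℝ} (h : a^2 ≤ b^2) (hb : 0 ≤ b) : a ≤ b := by
  by_contra hc
  push Not at hc
  nlinarith

theorem csin_normSq (x y : ℝ) : ‖Complex.sin (x + y * Complex.I)‖^2 = Real.sin x ^ 2 + Real.sinh y ^ 2 := by
  rw [Complex.sin_add_mul_I, ← Complex.ofReal_sin, ← Complex.ofReal_cos, ← Complex.ofReal_sinh, ← Complex.ofReal_cosh,
    ← Complex.ofReal_mul, ← Complex.ofReal_mul, Complex.sq_norm, Complex.normSq_add_mul_I]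
  have h1 := Real.cosh_sq y
  have h2 := Real.sin_sq_add_cos_sq x
  rw [mul_pow, mul_pow, h1]
  linear_combination (Real.sinh y ^ 2) * h2

theorem sin_circle {s : ℂ} {N : ℕ} (hN : 1 ≤ N) (hs : ‖s‖ = N + 1/2) :
    rexp (π * |s.im|) ≤ 10 * ‖Complex.sin (π * s)‖ := by
  have hN' : (1:ℝ) ≤ N := by exact_mod_cast hN
  have e : (π:ℂ) * s = ((π * s.re : ℝ) : ℂ) + ((π * s.im : ℝ) : ℂ) * Complex.I := by
    conv_lhs => rw [← Complex.re_add_im s]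
    push_cast; ring
  have hsq := csin_normSq (π * s.re) (π * s.im)
  rw [← e] at hsq
  have hpi := Real.pi_gt_three
  by_cases hy : 1/2 ≤ |s.im|
  · have h1 : Real.sinh (π * |s.im|) ≤ ‖Complex.sin (π * s)‖ := by
      refine le_of_sq_le_sq_aux ?_ (norm_nonneg _)
      rw [hsq]
      have : Real.sinh (π * |s.im|) ^ 2 = Real.sinh (π * s.im) ^ 2 := by
        rcases abs_choice s.im with h | h <;> rw [h]
        rw [mul_neg, Real.sinh_neg]; ring
      rw [this]
      nlinarith [sq_nonneg (Real.sin (π * s.re))]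
    have h2 : rexp (-(π * |s.im|)) ≤ 1 := Real.exp_le_one_iff.2 (by nlinarith)
    have h3 : (2:ℝ) ≤ rexp (π * |s.im|) := by
      have := Real.add_one_le_exp (π * |s.im|)
      nlinarith
    rw [Real.sinh_eq] at h1
    linarith
  · push Not at hy
    have h1 : rexp (π * |s.im|) ≤ 5 := by
      have hp := Real.pi_lt_d2
      have : rexp (π * |s.im|) ≤ rexp (1.6) := Real.exp_le_exp.2 (by nlinarith [abs_nonneg s.im])
      have h4 : rexp (1.6) ^ 5 = rexp 1 ^ 8 := by
        rw [← Real.exp_nat_mul, ← Real.exp_nat_mul]; norm_num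
      have h5 : rexp 1 ^ 8 ≤ 2.7182818286 ^ 8 := by
        gcongr; exact Real.exp_one_lt_d9.le
      have h6 : rexp 1.6 ^ 5 ≤ 5 ^ 5 := by
        rw [h4]; refine h5.trans (by norm_num)
      exact this.trans (le_of_pow_le_pow_left₀ (by norm_num) (by norm_num) h6)
    have h2 : 1/2 ≤ |Real.sin (π * s.re)| := by
      have hn : s.re^2 + s.im^2 = (N + 1/2)^2 := by
        rw [← hs, Complex.sq_norm, Complex.normSq_apply]; ring
      have hy2 : s.im^2 < 1/4 := by
        rw [← sq_abs]; nlinarith [abs_nonneg s.im]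
      have hx1 : |s.re| ≤ N + 1/2 := by rw [← hs]; exact Complex.abs_re_le_norm s
      have hx2 : N + 2/5 ≤ |s.re| := by
        refine le_of_sq_le_sq_aux ?_ (abs_nonneg _)
        rw [sq_abs]; nlinarith
      have e1 : |Real.sin (π * s.re)| = |Real.sin (π * |s.re|)| := by
        rcases abs_choice s.re with h | h <;> rw [h]
        rw [mul_neg, Real.sin_neg, abs_neg]
      set d := N + 1/2 - |s.re| with hd
      have e2 : π * |s.re| = (π / 2 - π * d) + N * π := by rw [hd]; ring
      rw [e1, e2, Real.sin_add_nat_mul_pi, Real.sin_pi_div_two_sub, abs_mul, abs_pow, abs_neg, abs_one, one_pow, one_mul]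
      have : Real.cos (π/3) ≤ Real.cos (π * d) := by
        apply Real.cos_le_cos_of_nonneg_of_le_pi
        · apply mul_nonneg Real.pi_pos.le; linarith
        · linarith
        · nlinarith
      rw [Real.cos_pi_div_three] at this
      exact this.trans (le_abs_self _)
    have h3 : 1/2 ≤ ‖Complex.sin (π * s)‖ := by
      refine le_of_sq_le_sq_aux ?_ (norm_nonneg _)
      rw [hsq, ← sq_abs (Real.sin _)]
      nlinarith [sq_nonneg (Real.sinh (π * s.im))]
    linarith

theorem G_exists : ∃ G : ℂ → ℂ, Differentiable ℂ G ∧ (∀ s, G (s^2) = -(s * Complex.sin (π * s))) ∧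
    (∀ l, G l = 0 ↔ ∃ j : ℕ, l = (j:ℂ)^2) ∧ (∀ l, G l = 0 → deriv G l ≠ 0) := by
  have hq : QI (fun _ => 0) := by simp [QI]
  obtain ⟨G, dG, -, hsimp, hval, -⟩ := char_exists hq (α := π/2) (β := π/2) (by simp)
  have hG : ∀ s, G (s^2) = -(s * Complex.sin (π * s)) := by
    intro s
    have d0 : ∀ t : ℝ, HasDerivAt (fun x : ℝ => s * (x:ℂ)) s t := fun t =>
      ((Complex.ofRealCLM.hasDerivAt (x := t)).const_mul s).congr_deriv (by simp)
    have d1 : ∀ t : ℝ, HasDerivAt (fun x : ℝ => Complex.cos (s * x)) (-s * Complex.sin (s * t)) t := fun t =>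
      ((Complex.hasDerivAt_cos _).comp t (d0 t)).congr_deriv (by ring)
    have d2 : ∀ t : ℝ, HasDerivAt (fun x : ℝ => -s * Complex.sin (s * x)) ((((0:ℝ):ℂ) - s^2) * Complex.cos (s * t)) t := fun t =>
      (((Complex.hasDerivAt_sin _).comp t (d0 t)).const_mul (-s)).congr_deriv (by push_cast; ring)
    have h := hval (s^2) (fun x => Complex.cos (s * x)) (fun x => -s * Complex.sin (s * x))
      ⟨Continuous.continuousOn (by fun_prop), Continuous.continuousOn (by fun_prop), ?_, ?_⟩ (by simp) (by simp)
    · rw [h]; simp; left; rw [mul_comm s π]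
    · intro x _
      beta_reduce
      rw [intervalIntegral.integral_eq_sub_of_hasDerivAt (fun t _ => d1 t)
        (Continuous.intervalIntegrable (by fun_prop) _ _)]
      ring
    · intro x _
      beta_reduce
      rw [intervalIntegral.integral_eq_sub_of_hasDerivAt (fun t _ => d2 t)
        (Continuous.intervalIntegrable (by fun_prop) _ _)]
      ring
  refine ⟨G, dG, hG, ?_, hsimp⟩
  intro l
  constructor
  · intro h
    obtain ⟨s, rfl⟩ := IsAlgClosed.exists_pow_nat_eq l (n := 2) (by norm_num)
    rw [hG, neg_eq_zero, mul_eq_zero] at h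
    rcases h with h | h
    · exact ⟨0, by simp [h]⟩
    · obtain ⟨k, hk⟩ := Complex.sin_eq_zero_iff.1 h
      have hpi : (π:ℂ) ≠ 0 := by exact_mod_cast Real.pi_ne_zero
      have : s = k := by
        apply mul_left_cancel₀ hpi; rw [hk]; ring
      refine ⟨k.natAbs, ?_⟩
      rw [this]
      have := Int.natAbs_sq k
      have h2 : (((k.natAbs:ℤ)^2 : ℤ) : ℂ) = ((k^2 : ℤ) : ℂ) := by rw [this]
      push_cast at h2
      rw [← h2]; simp
  · rintro ⟨j, rfl⟩
    rw [hG]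
    have := Complex.sin_nat_mul_pi j
    rw [mul_comm] at this
    rw [this]; simp


theorem factor_exists {F : ℂ → ℂ} (dF : Differentiable ℂ F) {f : ℕ → ℂ} (hfi : Function.Injective f)
    (hF : ∀ j, F (f j) = 0) (N : ℕ) :
    ∃ A : ℂ → ℂ, Differentiable ℂ A ∧ ∀ z, F z = A z * ∏ j ∈ Finset.range N, (f j - z) := by
  induction N with
  | zero => exact ⟨F, dF, by simp⟩
  | succ N ih =>
    obtain ⟨A, dA, hA⟩ := ih
    have h0 : A (f N) = 0 := by
      have := hA (f N)
      rw [hF, eq_comm, mul_eq_zero] at this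
      rcases this with h | h
      · exact h
      · obtain ⟨j, hj, h⟩ := Finset.prod_eq_zero_iff.1 h
        have := hfi (sub_eq_zero.1 h)
        simp [this] at hj
    refine ⟨fun z => - dslope A (f N) z, ?_, fun z => ?_⟩
    · have := (Complex.differentiableOn_dslope (f := A) (c := f N) (s := univ) Filter.univ_mem).2 dA.differentiableOn
      exact (differentiableOn_univ.1 this).neg
    · have := sub_smul_dslope A (f N) z
      rw [h0, sub_zero, smul_eq_mul] at this
      rw [hA z, ← this, Finset.prod_range_succ]
      ring

theorem harm_tendsto : Filter.Tendsto (fun N : ℕ => (N:ℝ)⁻¹ * ∑ i ∈ Finset.range N, 1/((i:ℝ)+1)) Filter.atTop (nhds 0) := by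
  have := (tendsto_one_div_add_atTop_nhds_zero_nat (𝕜 := ℝ)).cesaro
  exact this

theorem prod_ratio {f g : ℕ → ℂ} {C : ℝ} {d : ℕ} (hC : 0 ≤ C)
    (hf : ∀ j, ‖f j - ((j:ℂ)+d)^2‖ ≤ C) (hg : ∀ j, ‖g j - ((j:ℂ)+d)^2‖ ≤ C) (ε : ℝ) (hε : 0 < ε) :
    ∃ N0 : ℕ, ∀ N ≥ N0, ∀ z : ℂ, ‖z‖ = ((N:ℝ)+d-1/2)^2 →
      (∀ j < N, f j - z ≠ 0) ∧ 
      ‖∏ j ∈ Finset.range N, ((g j - z) / (f j - z)) - 1‖ ≤ ε := by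
  have hlog : 0 < Real.log (1+ε) := Real.log_pos (by linarith)
  have h1 := harm_tendsto.const_mul (16 * C)
  rw [mul_zero] at h1
  have h2 := h1.eventually (gt_mem_nhds hlog)
  obtain ⟨N1, hN1⟩ := Filter.eventually_atTop.1 h2
  obtain ⟨N2, hN2⟩ := exists_nat_gt (4 * C + 1)
  refine ⟨max N1 N2, fun N hN z hz => ?_⟩
  have a1 := hN1 N (le_of_max_le_left hN)
  have a2 : 4 * C + 1 < N := hN2.trans_le (by exact_mod_cast le_of_max_le_right hN)
  have low : ∀ j < N, ∀ i : ℕ, j + i + 1 = N → ((i:ℝ)+1) * N / 8 ≤ ‖f j - z‖ := by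
    intro j hj i hi
    have hi' : (N:ℝ) = j + i + 1 := by exact_mod_cast hi.symm
    have hj0 : (0:ℝ) ≤ j := by positivity
    have hi0 : (0:ℝ) ≤ i := by positivity
    have hd0 : (0:ℝ) ≤ d := by positivity
    have b1 : ‖z‖ ≤ ‖f j - z‖ + ‖f j - ((j:ℂ)+d)^2‖ + ‖((j:ℂ)+d)^2‖ := by
      have e : z = -(f j - z) + (f j - ((j:ℂ)+d)^2) + ((j:ℂ)+d)^2 := by ring
      conv_lhs => rw [e]
      refine (norm_add_le _ _).trans ?_
      refine (add_le_add (norm_add_le _ _) le_rfl).trans ?_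
      rw [norm_neg]
    have b2 : ‖((j:ℂ)+d)^2‖ = ((j:ℝ)+d)^2 := by
      rw [norm_pow]
      have : ((j:ℂ)+d) = ((j+d:ℕ):ℂ) := by push_cast; rfl
      rw [this, Complex.norm_natCast]; push_cast; rfl
    rw [hz, b2] at b1
    have b3 := hf j
    have b4 : ((i:ℝ)+1/2) * (N - 1/2) ≤ ((N:ℝ)+d-1/2)^2 - ((j:ℝ)+d)^2 := by
      have : ((N:ℝ)+d-1/2)^2 - ((j:ℝ)+d)^2 = ((i:ℝ)+1/2) * (N - 1/2 + j + 2 * d) := by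
        rw [hi']; ring
      rw [this]
      apply mul_le_mul_of_nonneg_left _ (by positivity)
      linarith
    have b5 : ((i:ℝ)+1) * N / 4 ≤ ((i:ℝ)+1/2) * (N - 1/2) := by nlinarith
    have b6 : C ≤ ((i:ℝ)+1) * N / 8 + ((i:ℝ)+1/2) * (N - 1/2)/2 - 0 := by nlinarith
    nlinarith
  have hne : ∀ j < N, f j - z ≠ 0 := by
    intro j hj h
    obtain ⟨i, hi⟩ := Nat.exists_eq_add_of_lt hj
    have := low j hj i hi.symm
    rw [h, norm_zero] at this
    have : 0 < ((i:ℝ)+1) * N / 8 := by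
      have : (0:ℝ) < N := by linarith
      positivity
    linarith
  refine ⟨hne, ?_⟩
  have e1 : ∏ j ∈ Finset.range N, ((g j - z) / (f j - z)) = ∏ j ∈ Finset.range N, (1 + (g j - f j) / (f j - z)) := by
    apply Finset.prod_congr rfl
    intro j hj
    have := hne j (Finset.mem_range.1 hj)
    field_simp; ring
  rw [e1]
  refine (Finset.norm_prod_one_add_sub_one_le _ _).trans ?_
  have e2 : ∑ j ∈ Finset.range N, ‖(g j - f j) / (f j - z)‖ ≤ 16 * C * ((N:ℝ)⁻¹ * ∑ i ∈ Finset.range N, 1/((i:ℝ)+1)) := by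
    rw [← Finset.sum_range_reflect (fun i : ℕ => 1/((i:ℝ)+1)), Finset.mul_sum, Finset.mul_sum]
    apply Finset.sum_le_sum
    intro j hj
    have hj' := Finset.mem_range.1 hj
    have hl := low j hj' (N-1-j) (by omega)
    have hgf : ‖g j - f j‖ ≤ 2 * C := by
      have : g j - f j = (g j - ((j:ℂ)+d)^2) - (f j - ((j:ℂ)+d)^2) := by ring
      rw [this]
      refine (norm_sub_le _ _).trans ?_
      linarith [hf j, hg j]
    rw [norm_div]
    have hN0 : (0:ℝ) < N := by linarith
    calc ‖g j - f j‖ / ‖f j - z‖ ≤ 2 * C / ((((N-1-j:ℕ):ℝ)+1) * N / 8) := by gcongr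
      _ = _ := by field_simp; ring
  have : rexp (∑ j ∈ Finset.range N, ‖(g j - f j) / (f j - z)‖) ≤ 1 + ε := by
    rw [← Real.exp_log (show 0 < 1 + ε by linarith)]
    exact Real.exp_le_exp.2 (e2.trans a1.le)
  linarith

theorem compL {F G : ℂ → ℂ} (dF : Differentiable ℂ F) (dG : Differentiable ℂ G) {f g : ℕ → ℂ}
    (hfi : Function.Injective f) (hgi : Function.Injective g)
    (hG : ∀ z, G z = 0 → ∃ j, z = g j) (hG0 : ∀ j, G (g j) = 0) (hG' : ∀ j, deriv G (g j) ≠ 0)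
    (hF : ∀ j, F (f j) = 0) {C : ℝ} {d : ℕ}
    (hf : ∀ j, ‖f j - ((j:ℂ)+d)^2‖ ≤ C) (hg : ∀ j, ‖g j - ((j:ℂ)+d)^2‖ ≤ C)
    (hr : ∀ ε > 0, ∃ N0 : ℕ, ∀ N ≥ N0, ∀ z : ℂ, ‖z‖ = ((N:ℝ)+1/2)^2 → ‖F z - G z‖ ≤ ε * ‖G z‖)
    (ε : ℝ) (hε : 0 < ε) :
    ∃ N0 : ℕ, ∀ N ≥ N0, ∃ A B : ℂ → ℂ, Differentiable ℂ A ∧ Differentiable ℂ B ∧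
      (∀ z, F z = A z * ∏ j ∈ Finset.range N, (f j - z)) ∧
      (∀ z, G z = B z * ∏ j ∈ Finset.range N, (g j - z)) ∧
      ∀ z : ℂ, ‖z‖ ≤ ((N:ℝ)+d-1/2)^2 → ‖A z - B z‖ ≤ ε * ‖B z‖ ∧ B z ≠ 0 := by
  have hC : 0 ≤ C := (norm_nonneg _).trans (hf 0)
  set δ := min 1 (ε/3) with hδ
  have hδ0 : 0 < δ := by positivity
  have hδ1 : δ ≤ 1 := min_le_left _ _
  have hδε : δ ≤ ε/3 := min_le_right _ _
  obtain ⟨N1, hN1⟩ := prod_ratio hC hf hg δ hδ0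
  obtain ⟨N1', hN1'⟩ := prod_ratio hC hg hf δ hδ0
  obtain ⟨N2, hN2⟩ := hr δ hδ0
  obtain ⟨N3, hN3⟩ := exists_nat_gt (C + 1)
  refine ⟨N1 + N1' + N2 + N3 + 1, fun N hN => ?_⟩
  obtain ⟨A, dA, hA⟩ := factor_exists dF hfi hF N
  obtain ⟨B, dB, hB⟩ := factor_exists dG hgi hG0 N
  refine ⟨A, B, dA, dB, hA, hB, ?_⟩
  have hN3' : C + 1 < N := hN3.trans_le (by exact_mod_cast (by omega : N3 ≤ N))
  set R : ℝ := ((N:ℝ)+d-1/2)^2 with hR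
  have hd0 : (0:ℝ) ≤ d := by positivity
  have hR0 : R ≠ 0 := by
    have : 0 < (N:ℝ)+d-1/2 := by linarith
    positivity
  have hBne : ∀ z : ℂ, ‖z‖ ≤ R → B z ≠ 0 := by
    intro z hz hBz
    have hGz : G z = 0 := by rw [hB, hBz, zero_mul]
    obtain ⟨j, rfl⟩ := hG z hGz
    by_cases hj : j < N
    · apply hG' j
      have d1 : HasDerivAt (fun z => B z * ∏ j ∈ Finset.range N, (g j - z)) 
          (deriv B (g j) * (∏ k ∈ Finset.range N, (g k - g j)) + B (g j) * deriv (fun z => ∏ j ∈ Finset.range N, (g j - z)) (g j)) (g j) := by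
        refine (dB _).hasDerivAt.mul (DifferentiableAt.hasDerivAt ?_)
        fun_prop
      have e : G = fun z => B z * ∏ j ∈ Finset.range N, (g j - z) := funext hB
      rw [e, d1.deriv, hBz, Finset.prod_eq_zero (Finset.mem_range.2 hj) (sub_self _)]
      ring
    · push Not at hj
      have hj' : (N:ℝ) ≤ j := by exact_mod_cast hj
      have b2 : ‖((j:ℂ)+d)^2‖ = ((j:ℝ)+d)^2 := by
        rw [norm_pow]
        have : ((j:ℂ)+d) = ((j+d:ℕ):ℂ) := by push_cast; rfl
        rw [this, Complex.norm_natCast]; push_cast; rfl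
      have b1 : ‖((j:ℂ)+d)^2‖ ≤ ‖g j‖ + ‖g j - ((j:ℂ)+d)^2‖ := by
        have e : ((j:ℂ)+d)^2 = g j - (g j - ((j:ℂ)+d)^2) := by ring
        conv_lhs => rw [e]
        exact norm_sub_le _ _
      rw [b2] at b1
      have := hg j
      have : ((N:ℝ)+d)^2 ≤ ((j:ℝ)+d)^2 := by gcongr
      nlinarith
  intro z hz
  refine ⟨?_, hBne z hz⟩
  have hfr : ∀ w : ℂ, ‖w‖ = R → ‖(A w - B w) / B w‖ ≤ ε := by
    intro w hw
    obtain ⟨p1, p2⟩ := hN1 N (by omega) w hw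
    obtain ⟨p1', -⟩ := hN1' N (by omega) w hw
    have p3 := hN2 (N+d-1) (by omega) w (by rw [hw, hR]; rw [Nat.cast_sub (by omega)]; push_cast; ring)
    set P := ∏ j ∈ Finset.range N, (f j - w) with hP
    set Q := ∏ j ∈ Finset.range N, (g j - w) with hQ
    have hP0 : P ≠ 0 := Finset.prod_ne_zero_iff.2 fun j hj => p1 j (Finset.mem_range.1 hj)
    have hQ0 : Q ≠ 0 := Finset.prod_ne_zero_iff.2 fun j hj => p1' j (Finset.mem_range.1 hj)
    rw [Finset.prod_div_distrib] at p2
    have hB0 := hBne w hw.le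
    have hG0 : G w ≠ 0 := by rw [hB]; exact mul_ne_zero hB0 hQ0
    set a := (F w - G w) / G w with ha
    set b := Q / P - 1 with hb
    have na : ‖a‖ ≤ δ := by rw [ha, norm_div, div_le_iff₀ (norm_pos_iff.2 hG0)]; exact p3
    have e : (A w - B w) / B w = a * b + a + b := by
      have e1 : A w = F w / P := by rw [hA w, mul_div_assoc, ← hP, div_self hP0, mul_one]
      have e2 : B w = G w / Q := by rw [hB w, mul_div_assoc, ← hQ, div_self hQ0, mul_one]
      rw [e1, e2, ha, hb]
      field_simp
      ring
    rw [e]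
    refine (norm_add_le _ _).trans ?_
    refine (add_le_add (norm_add_le _ _) le_rfl).trans ?_
    rw [norm_mul]
    have : ‖a‖ * ‖b‖ ≤ δ * δ := mul_le_mul na p2 (norm_nonneg _) hδ0.le
    nlinarith
  have hm := Complex.norm_le_of_forall_mem_frontier_norm_le (f := fun w => (A w - B w) / B w) (C := ε)
    (U := Metric.ball (0:ℂ) R) Metric.isBounded_ball ?_ ?_ (z := z) ?_
  · rw [norm_div, div_le_iff₀ (norm_pos_iff.2 (hBne z hz))] at hm
    exact hm
  · apply DifferentiableOn.diffContOnCl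
    rw [closure_ball _ hR0]
    intro w hw
    exact ((dA w).sub (dB w)).div (dB w) (hBne w (by simpa using hw)) |>.differentiableWithinAt
  · intro w hw
    rw [frontier_ball _ hR0] at hw
    exact hfr w (by simpa using hw)
  · rw [closure_ball _ hR0]; simpa using hz

theorem compL_zeros {F G : ℂ → ℂ} (dF : Differentiable ℂ F) (dG : Differentiable ℂ G) {f g : ℕ → ℂ}
    (hfi : Function.Injective f) (hgi : Function.Injective g)
    (hG : ∀ z, G z = 0 → ∃ j, z = g j) (hG0 : ∀ j, G (g j) = 0) (hG' : ∀ j, deriv G (g j) ≠ 0)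
    (hF : ∀ j, F (f j) = 0) {C : ℝ} {d : ℕ}
    (hf : ∀ j, ‖f j - ((j:ℂ)+d)^2‖ ≤ C) (hg : ∀ j, ‖g j - ((j:ℂ)+d)^2‖ ≤ C)
    (hr : ∀ ε > 0, ∃ N0 : ℕ, ∀ N ≥ N0, ∀ z : ℂ, ‖z‖ = ((N:ℝ)+1/2)^2 → ‖F z - G z‖ ≤ ε * ‖G z‖)
    (z : ℂ) (hz : F z = 0) : ∃ j, z = f j := by
  obtain ⟨N0, h⟩ := compL dF dG hfi hgi hG hG0 hG' hF hf hg hr (1/2) (by norm_num)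
  obtain ⟨M, hM⟩ := exists_nat_gt (‖z‖ + 1)
  obtain ⟨A, B, -, -, hA, -, H⟩ := h (max N0 M) (le_max_left _ _)
  have hM' : (M:ℝ) ≤ (max N0 M : ℕ) := by exact_mod_cast le_max_right _ _
  obtain ⟨h1, h2⟩ := H z (by
    have := norm_nonneg z
    have hd0 : (0:ℝ) ≤ d := by positivity
    nlinarith)
  have hA0 : A z ≠ 0 := by
    intro h0
    rw [h0, zero_sub, norm_neg] at h1
    have := norm_pos_iff.2 h2
    linarith
  rw [hA, mul_eq_zero] at hz
  rcases hz with h | h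
  · exact absurd h hA0
  · obtain ⟨j, -, hj⟩ := Finset.prod_eq_zero_iff.1 h
    exact ⟨j, (sub_eq_zero.1 hj).symm⟩


theorem ratio_hyp {F G0 : ℂ → ℂ} {C0 C S : ℝ} (hC0 : 0 < C0) (hC : 0 ≤ C)
    (hG : ∀ s, G0 (s^2) = -(s * Complex.sin (π * s)))
    (hF : ∀ s : ℂ, S ≤ ‖s‖ → ‖F (s^2) + (C0:ℂ) * (s * Complex.sin (π * s))‖ ≤ C * rexp (π * |s.im|)) :
    ∀ ε > 0, ∃ N0 : ℕ, ∀ N ≥ N0, ∀ z : ℂ, ‖z‖ = ((N:ℝ)+1/2)^2 → ‖F z - C0 * G0 z‖ ≤ ε * ‖C0 * G0 z‖ := by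
  intro ε hε
  obtain ⟨N1, h1⟩ := exists_nat_gt S
  obtain ⟨N2, h2⟩ := exists_nat_gt (10 * C / (C0 * ε))
  refine ⟨N1 + N2 + 1, fun N hN z hz => ?_⟩
  obtain ⟨s, rfl⟩ := IsAlgClosed.exists_pow_nat_eq z (n := 2) (by norm_num)
  have hs : ‖s‖ = N + 1/2 := by
    rw [norm_pow] at hz
    exact (pow_left_inj₀ (norm_nonneg _) (by positivity) (by norm_num)).1 hz
  have hN1 : (N1:ℝ) ≤ N := by exact_mod_cast (by omega : N1 ≤ N)
  have hN2 : (N2:ℝ) ≤ N := by exact_mod_cast (by omega : N2 ≤ N)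
  have a1 := hF s (by rw [hs]; linarith)
  have a2 := sin_circle (by omega) hs
  rw [hG]
  have e : F (s^2) - C0 * -(s * Complex.sin (π * s)) = F (s^2) + (C0:ℂ) * (s * Complex.sin (π * s)) := by ring
  rw [e]
  refine a1.trans ?_
  rw [norm_mul, norm_neg, norm_mul, hs, Complex.norm_real, Real.norm_of_nonneg hC0.le]
  rw [div_lt_iff₀ (by positivity)] at h2
  have h3 : 10 * C ≤ ε * (C0 * (N + 1/2)) := by
    have : (N2:ℝ) * (C0 * ε) ≤ (N + 1/2) * (C0 * ε) := by
      apply mul_le_mul_of_nonneg_right _ (by positivity); linarith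
    linarith
  calc C * rexp (π * |s.im|) ≤ C * (10 * ‖Complex.sin (π * s)‖) := by gcongr
    _ = (10 * C) * ‖Complex.sin (π * s)‖ := by ring
    _ ≤ (ε * (C0 * (N + 1/2))) * ‖Complex.sin (π * s)‖ := by gcongr
    _ = _ := by ring

theorem ratio_symm {F G : ℂ → ℂ} 
    (hr : ∀ ε > 0, ∃ N0 : ℕ, ∀ N ≥ N0, ∀ z : ℂ, ‖z‖ = ((N:ℝ)+1/2)^2 → ‖F z - G z‖ ≤ ε * ‖G z‖) :
    ∀ ε > 0, ∃ N0 : ℕ, ∀ N ≥ N0, ∀ z : ℂ, ‖z‖ = ((N:ℝ)+1/2)^2 → ‖G z - F z‖ ≤ ε * ‖F z‖ := by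
  intro ε hε
  obtain ⟨N0, h⟩ := hr (min (1/2) (ε/2)) (by positivity)
  refine ⟨N0, fun N hN z hz => ?_⟩
  have h1 := h N hN z hz
  have h2 : ‖F z - G z‖ ≤ 1/2 * ‖G z‖ := h1.trans (by gcongr; exact min_le_left _ _)
  have h3 : ‖F z - G z‖ ≤ ε/2 * ‖G z‖ := h1.trans (by gcongr; exact min_le_right _ _)
  have h4 : ‖G z‖ ≤ ‖F z‖ + ‖F z - G z‖ := by
    have : G z = F z - (F z - G z) := by ring
    conv_lhs => rw [this]
    exact norm_sub_le _ _
  rw [norm_sub_rev]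
  have h5 : ‖G z‖ ≤ 2 * ‖F z‖ := by linarith
  nlinarith

theorem real_zeros {F : ℂ → ℂ} (dF : Differentiable ℂ F) {Fr : ℝ → ℝ} (hFr : ∀ x : ℝ, F x = Fr x)
    {C0 C S : ℝ} (hC0 : 0 < C0) (hC : 0 ≤ C)
    (hF : ∀ s : ℂ, S ≤ ‖s‖ → ‖F (s^2) + (C0:ℂ) * (s * Complex.sin (π * s))‖ ≤ C * rexp (π * |s.im|)) :
    ∃ (K : ℕ) (E : ℝ) (zz : ℕ → ℝ), 0 ≤ E ∧ (∀ k ≥ K, Fr (zz k) = 0 ∧ |zz k - (k:ℝ)^2| ≤ E) ∧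
      ∀ j k, K ≤ j → j < k → zz j < zz k := by
  have cF : Continuous Fr := by
    have : Fr = fun x : ℝ => (F x).re := by ext x; rw [hFr]; simp
    rw [this]
    exact Complex.continuous_re.comp (dF.continuous.comp Complex.continuous_ofReal)
  have hR : ∀ s : ℝ, S ≤ s → |Fr (s^2) + C0 * (s * Real.sin (π * s))| ≤ C := by
    intro s hs
    have := hF s (by rw [Complex.norm_real]; exact hs.trans (le_abs_self _))
    rw [Complex.ofReal_im, abs_zero, mul_zero, Real.exp_zero, mul_one] at this
    rw [← Real.norm_eq_abs, ← Complex.norm_real]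
    refine le_trans (le_of_eq ?_) this
    congr 1
    push_cast
    rw [← hFr]
    push_cast
    rfl
  set D := C / C0 + 1 with hD
  have hD0 : 0 < D := by positivity
  have hCD : C < C0 * D := by rw [hD, mul_add, mul_div_cancel₀ _ hC0.ne']; linarith
  obtain ⟨K, hK⟩ := exists_nat_gt (|S| + 4 * D + 1)
  have key : ∀ k : ℕ, K ≤ k → ∃ s : ℝ, Fr (s^2) = 0 ∧ |s - k| ≤ D / k ∧ (1:ℝ) ≤ k ∧ D / k ≤ 1/4 := by
    intro k hk
    have hk' : |S| + 4 * D + 1 < k := hK.trans_le (by exact_mod_cast hk)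
    have hS := le_abs_self S
    have hS' := abs_nonneg S
    have hk1 : (1:ℝ) ≤ k := by linarith
    have hk0 : (0:ℝ) < k := by linarith
    set t := D / k with ht
    have ht0 : 0 < t := by positivity
    have ht4 : t ≤ 1/4 := by rw [ht, div_le_iff₀ hk0]; linarith
    have htk : t * k = D := by rw [ht]; field_simp
    have hsin : 2 * t ≤ Real.sin (π * t) := by
      have := Real.mul_le_sin (x := π * t) (by positivity) (by nlinarith [Real.pi_pos])
      have e : 2 / π * (π * t) = 2 * t := by field_simp
      rwa [e] at this
    have e1 : Real.sin (π * (k + t)) = (-1)^k * Real.sin (π * t) := by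
      rw [show π * (k + t) = π * t + k * π by ring, Real.sin_add_nat_mul_pi]
    have e2 : Real.sin (π * (k - t)) = - ((-1)^k * Real.sin (π * t)) := by
      rw [show π * (k - t) = -(π * t) + k * π by ring, Real.sin_add_nat_mul_pi, Real.sin_neg]; ring
    have r1 := hR (k + t) (by linarith)
    have r2 := hR (k - t) (by linarith)
    rw [e1] at r1
    rw [e2] at r2
    have p1 : C < C0 * ((k + t) * Real.sin (π * t)) := by
      refine hCD.trans_le (mul_le_mul_of_nonneg_left ?_ hC0.le)
      nlinarith
    have p2 : C < C0 * ((k - t) * Real.sin (π * t)) := by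
      refine hCD.trans_le (mul_le_mul_of_nonneg_left ?_ hC0.le)
      nlinarith
    rw [abs_le] at r1 r2
    have hpm : ((-1:ℝ)^k = 1) ∨ ((-1:ℝ)^k = -1) := neg_one_pow_eq_or ℝ k
    have hcont : Continuous (fun s : ℝ => (-1:ℝ)^k * Fr (s^2)) := by fun_prop
    have hiv := intermediate_value_Icc' (a := (k:ℝ) - t) (b := k + t) (by linarith) hcont.continuousOn
    have h0 : (0:ℝ) ∈ Icc ((-1:ℝ)^k * Fr ((k+t)^2)) ((-1:ℝ)^k * Fr ((k-t)^2)) := by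
      rcases hpm with h | h <;> rw [h] at r1 r2 ⊢ <;> constructor <;> linarith [r1.1, r1.2, r2.1, r2.2]
    obtain ⟨s, hs, hs0⟩ := hiv h0
    refine ⟨s, ?_, ?_, hk1, ht4⟩
    · rcases mul_eq_zero.1 hs0 with h | h
      · exact absurd h (by positivity)
      · exact h
    · rw [abs_le]; constructor <;> linarith [hs.1, hs.2]
  choose! s hs using key
  refine ⟨K, 2 * D + D^2, fun k => (s k)^2, by positivity, fun k hk => ?_, fun j k hj hjk => ?_⟩
  · obtain ⟨a, b, c, e⟩ := hs k hk
    refine ⟨a, ?_⟩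
    have : (s k)^2 - (k:ℝ)^2 = (s k - k) * ((s k - k) + 2 * k) := by ring
    rw [this, abs_mul]
    have hk0 : (0:ℝ) < k := by linarith
    have h1 : |s k - k + 2 * k| ≤ D / k + 2 * k := by
      refine (abs_add_le _ _).trans ?_
      rw [abs_of_nonneg (show (0:ℝ) ≤ 2 * k by positivity)]; linarith
    have hD1 : D / k ≤ D := div_le_self hD0.le c
    have hD2 : 0 ≤ D / k := by positivity
    calc _ ≤ D / k * (D / k + 2 * k) := mul_le_mul b h1 (abs_nonneg _) hD2
      _ = D / k * (D / k) + 2 * D := by field_simp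
      _ ≤ _ := by nlinarith
  · obtain ⟨a, b, c, e⟩ := hs j hj
    obtain ⟨a', b', c', e'⟩ := hs k (hj.trans hjk.le)
    have hjk' : (j:ℝ) + 1 ≤ k := by exact_mod_cast hjk
    rw [abs_le] at b b'
    beta_reduce
    apply pow_lt_pow_left₀ _ _ (by norm_num)
    · linarith
    · linarith

theorem bdd_fix {a : ℕ → ℝ} {K : ℕ} {E : ℝ} (hE : 0 ≤ E) (h : ∀ k ≥ K, |a k| ≤ E) :
    ∃ C, ∀ k, |a k| ≤ C := by
  refine ⟨E + ∑ j ∈ Finset.range K, |a j|, fun k => ?_⟩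
  by_cases hk : K ≤ k
  · have : 0 ≤ ∑ j ∈ Finset.range K, |a j| := Finset.sum_nonneg fun _ _ => abs_nonneg _
    linarith [h k hk]
  · have := Finset.single_le_sum (f := fun j => |a j|) (fun _ _ => abs_nonneg _) (Finset.mem_range.2 (not_le.1 hk))
    beta_reduce at this
    linarith

theorem nrm_aux (x : ℝ) (j d : ℕ) : ‖(x:ℂ) - ((j:ℂ)+d)^2‖ = |x - ((j:ℝ)+d)^2| := by
  rw [← Real.norm_eq_abs, ← Complex.norm_real]; push_cast; rfl

theorem indexing {F G0 : ℂ → ℂ} (dF : Differentiable ℂ F) (dG : Differentiable ℂ G0)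
    {Fr : ℝ → ℝ} (hFr : ∀ x : ℝ, F x = Fr x)
    {C0 C S : ℝ} (hC0 : 0 < C0) (hC : 0 ≤ C)
    (hF : ∀ s : ℂ, S ≤ ‖s‖ → ‖F (s^2) + (C0:ℂ) * (s * Complex.sin (π * s))‖ ≤ C * rexp (π * |s.im|))
    (hG : ∀ s, G0 (s^2) = -(s * Complex.sin (π * s)))
    (hGz : ∀ l, G0 l = 0 ↔ ∃ j : ℕ, l = (j:ℂ)^2) (hGd : ∀ l, G0 l = 0 → deriv G0 l ≠ 0)
    {μ : ℕ → ℝ} (hμ : StrictMono μ) (hFz : ∀ l, F l = 0 ↔ ∃ j, l = (μ j : ℂ)) 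
    (hFd : ∀ l, F l = 0 → deriv F l ≠ 0) :
    ∃ C, ∀ k : ℕ, |μ k - (k:ℝ)^2| ≤ C := by
  obtain ⟨K, E, zz, hE, hzz, hzm⟩ := real_zeros dF hFr hC0 hC hF
  have hr := ratio_hyp (F := F) (G0 := G0) hC0 hC hG hF
  have hC0' : (C0:ℂ) ≠ 0 := by exact_mod_cast hC0.ne'
  have hex : ∀ k, K ≤ k → ∃ i, zz k = μ i := by
    intro k hk
    have : F (zz k) = 0 := by rw [hFr, (hzz k hk).1]; simp
    obtain ⟨i, hi⟩ := (hFz _).1 this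
    exact ⟨i, by exact_mod_cast hi⟩
  choose! σ hσ using hex
  have σm : ∀ j k, K ≤ j → j < k → σ j < σ k := by
    intro j k hj hjk
    have := hzm j k hj hjk
    rwa [hσ j hj, hσ k (hj.trans hjk.le), hμ.lt_iff_lt] at this
  have hμi : Function.Injective (fun j => ((μ j : ℝ) : ℂ)) := fun a b h => hμ.injective (Complex.ofReal_injective h)
  have dG' : Differentiable ℂ (fun z => (C0:ℂ) * G0 z) := dG.const_mul _
  have hGz' : ∀ l, (C0:ℂ) * G0 l = 0 ↔ ∃ j : ℕ, l = (j:ℂ)^2 := by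
    intro l; rw [← hGz]; simp [hC0']
  have hGd' : ∀ l, (C0:ℂ) * G0 l = 0 → deriv (fun z => (C0:ℂ) * G0 z) l ≠ 0 := by
    intro l hl
    rw [deriv_const_mul _ (dG l)]
    exact mul_ne_zero hC0' (hGd l ((mul_eq_zero.1 hl).resolve_left hC0'))
  by_cases hcase : ∃ K1, K ≤ K1 ∧ K1 ≤ σ K1
  · obtain ⟨K1, hK1, hσK⟩ := hcase
    set τ : ℕ → ℕ := fun j => if j < K1 then j else σ j with hτ
    have τm : StrictMono τ := by
      have h1 : ∀ k, K1 ≤ k → K1 ≤ σ k := by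
        intro k hk
        rcases hk.eq_or_lt with rfl | h
        · exact hσK
        · exact hσK.trans (σm _ _ hK1 h).le
      intro a b hab
      simp only [hτ]
      split_ifs with ha hb hb
      · exact hab
      · exact lt_of_lt_of_le ha (h1 b (not_lt.1 hb))
      · omega
      · exact σm _ _ (hK1.trans (not_lt.1 ha)) hab
    have hb : ∀ k ≥ K1, |μ (τ k) - (k:ℝ)^2| ≤ E := by
      intro k hk
      have h1 := hzz k (hK1.trans hk)
      rw [hσ k (hK1.trans hk)] at h1
      simp only [hτ, not_lt.2 hk, if_false]
      exact h1.2
    obtain ⟨C2, hC2⟩ := bdd_fix (a := fun k => μ (τ k) - (k:ℝ)^2) hE hb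
    have hC2' : 0 ≤ C2 := (abs_nonneg _).trans (hC2 0)
    have hz := compL_zeros (F := F) (G := fun z => (C0:ℂ) * G0 z) dF dG' (f := fun j => ((μ (τ j) : ℝ) : ℂ))
      (g := fun j => (j:ℂ)^2) (hμi.comp τm.injective) (fun a b h => by
        have h' : (a:ℂ)^2 = (b:ℂ)^2 := h
        have : a^2 = b^2 := by exact_mod_cast h'
        exact Nat.pow_left_injective (n := 2) (by norm_num) this) (fun z hz => (hGz' z).1 hz)
        (fun j => (hGz' _).2 ⟨j, rfl⟩) (fun j => hGd' _ ((hGz' _).2 ⟨j, rfl⟩)) (fun j => (hFz _).2 ⟨_, rfl⟩)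
        (C := C2) (d := 0) (fun j => by rw [nrm_aux]; simpa using hC2 j) (fun j => by simpa using hC2') hr
    have hsurj : range τ = range (id : ℕ → ℕ) := by
      rw [range_id]
      apply eq_univ_of_forall
      intro i
      obtain ⟨j, hj⟩ := hz (μ i) ((hFz _).2 ⟨i, rfl⟩)
      exact ⟨j, (hμi hj).symm⟩
    have hid : τ = id := (StrictMono.range_inj τm strictMono_id).1 hsurj
    rw [hid] at hC2
    exact ⟨C2, hC2⟩
  · exfalso
    push Not at hcase
    obtain ⟨k0, hk0, d, hd1, hd⟩ : ∃ k0, K ≤ k0 ∧ ∃ d, 1 ≤ d ∧ ∀ k, k0 ≤ k → σ k + d = k := by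
      set e : ℕ → ℕ := fun n => (K + n) - σ (K + n) with he
      have hane : (range e).Nonempty := ⟨_, 0, rfl⟩
      obtain ⟨n, hn⟩ := Nat.sInf_mem hane
      refine ⟨K + n, by omega, e n, ?_, fun k hk => ?_⟩
      · have := hcase (K+n) (by omega)
        simp only [he]; omega
      · have hmin : e n ≤ e (k - K) := by rw [hn]; exact Nat.sInf_le ⟨_, rfl⟩
        have hanti : ∀ m, σ (K + n) + m ≤ σ (K + n + m) := by
          intro m
          induction m with
          | zero => simp
          | succ m ih =>
            have := σm (K+n+m) (K+n+(m+1)) (by omega) (by omega)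
            omega
        have h1 := hanti (k - (K + n))
        have h2 := hcase k (by omega)
        have h3 := hcase (K+n) (by omega)
        simp only [he] at hmin ⊢
        rw [show K + (k - K) = k by omega] at hmin
        rw [show K + n + (k - (K + n)) = k by omega] at h1
        omega
    have hb : ∀ j ≥ k0, |μ j - ((j:ℝ)+d)^2| ≤ E := by
      intro j hj
      have h1 := hzz (j+d) (by omega)
      rw [hσ _ (by omega)] at h1
      have h2 := hd (j+d) (by omega)
      have h3 : σ (j+d) = j := by omega
      rw [h3] at h1
      have := h1.2
      push_cast at this
      exact this
    obtain ⟨C2, hC2⟩ := bdd_fix (a := fun j => μ j - ((j:ℝ)+d)^2) hE hb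
    have hC2' : 0 ≤ C2 := (abs_nonneg _).trans (hC2 0)
    have hz := compL_zeros (F := fun z => (C0:ℂ) * G0 z) (G := F) dG' dF (f := fun j => ((j:ℂ)+d)^2)
      (g := fun j => ((μ j : ℝ) : ℂ)) (fun a b h => by
        have h' : ((a:ℂ)+d)^2 = ((b:ℂ)+d)^2 := h
        have : (a+d)^2 = (b+d)^2 := by exact_mod_cast h'
        have := Nat.pow_left_injective (n := 2) (by norm_num) this
        exact Nat.add_right_cancel this) hμi (fun z hz => (hFz z).1 hz) (fun j => (hFz _).2 ⟨j, rfl⟩)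
        (fun j => hFd _ ((hFz _).2 ⟨j, rfl⟩)) (fun j => (hGz' _).2 ⟨j+d, by push_cast; rfl⟩) (C := C2) (d := d)
        (fun j => by simpa using hC2') (fun j => by rw [nrm_aux]; exact hC2 j) (ratio_symm hr) 0
        ((hGz' _).2 ⟨0, by simp⟩)
    obtain ⟨j, hj⟩ := hz
    have : (j + d)^2 = 0 := by exact_mod_cast hj.symm
    have := pow_eq_zero_iff (two_ne_zero) |>.1 this
    omega


theorem mult_p {μ : ℕ → ℝ} {C : ℝ} (hμC : ∀ k : ℕ, |μ k - (k:ℝ)^2| ≤ C) (n : ℕ) :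
    Multipliable (fun k : ℕ => if k = 0 ∨ k = n then (1:ℝ) else (μ k - μ n) / (k : ℝ) ^ 2) := by
  have h : (fun k : ℕ => if k = 0 ∨ k = n then (1:ℝ) else (μ k - μ n) / (k : ℝ) ^ 2) =
      fun k => 1 + (if k = 0 ∨ k = n then (0:ℝ) else (μ k - μ n) / (k : ℝ) ^ 2 - 1) := by
    ext k; split_ifs <;> ring
  rw [h]
  apply multipliable_one_add_of_summable
  have hs : Summable (fun k : ℕ => (C + |μ n|) * ((k:ℝ)^2)⁻¹) :=
    (Real.summable_nat_pow_inv.2 (by norm_num)).mul_left _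
  have hC : 0 ≤ C := (abs_nonneg _).trans (hμC 0)
  refine Summable.of_nonneg_of_le (fun _ => norm_nonneg _) (fun k => ?_) hs
  split_ifs with hk
  · simp; positivity
  · push Not at hk
    have hk0 : (0:ℝ) < (k:ℝ)^2 := by
      have : (0:ℝ) < k := by exact_mod_cast Nat.pos_of_ne_zero hk.1
      positivity
    have : (μ k - μ n) / (k : ℝ) ^ 2 - 1 = (μ k - (k:ℝ)^2 - μ n) * ((k:ℝ)^2)⁻¹ := by
      rw [sub_right_comm, sub_mul _ ((k:ℝ)^2), mul_inv_cancel₀ hk0.ne']; ring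
    rw [this, norm_mul, Real.norm_of_nonneg (inv_nonneg.2 hk0.le), Real.norm_eq_abs]
    gcongr
    refine (abs_sub _ _).trans ?_
    linarith [hμC k]

theorem prod_id (μ : ℕ → ℝ) (n : ℕ) (hn : 1 ≤ n) (M : ℕ) (hM : n ≤ M) :
    (∏ j ∈ (Finset.range (M+1)).erase n, (μ j - μ n)) * (n:ℝ)^2 =
      (μ 0 - μ n) * (∏ j ∈ Finset.range (M+1), (if j = 0 ∨ j = n then (1:ℝ) else (μ j - μ n) / (j : ℝ) ^ 2)) *
        ∏ i ∈ Finset.range M, ((i:ℝ)+1)^2 := by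
  have e1 : ∏ j ∈ (Finset.range (M+1)).erase n, (μ j - μ n) = ∏ j ∈ Finset.range (M+1), (if j = n then 1 else μ j - μ n) := by
    rw [← Finset.prod_erase (a := n) (f := fun j => if j = n then 1 else μ j - μ n) _ (by simp)]
    apply Finset.prod_congr rfl
    intro j hj
    rw [if_neg (Finset.ne_of_mem_erase hj)]
  have e2 : (n:ℝ)^2 = ∏ j ∈ Finset.range (M+1), (if j = n then (j:ℝ)^2 else 1) := by
    rw [Finset.prod_ite_eq' , if_pos (Finset.mem_range.2 (by omega))]
  have e3 : μ 0 - μ n = ∏ j ∈ Finset.range (M+1), (if j = 0 then μ j - μ n else 1) := by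
    rw [Finset.prod_ite_eq' , if_pos (Finset.mem_range.2 (by omega))]
  have e4 : ∏ i ∈ Finset.range M, ((i:ℝ)+1)^2 = ∏ j ∈ Finset.range (M+1), (if j = 0 then 1 else (j:ℝ)^2) := by
    rw [Finset.prod_range_succ']; simp
  rw [e1, e2, e3, e4, ← Finset.prod_mul_distrib, ← Finset.prod_mul_distrib, ← Finset.prod_mul_distrib]
  apply Finset.prod_congr rfl
  intro j _
  by_cases h0 : j = 0
  · subst h0
    have : (0:ℕ) ≠ n := by omega
    simp [this]
  · have : (j:ℝ) ≠ 0 := by exact_mod_cast h0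
    by_cases hj : j = n
    · simp [hj, show n ≠ 0 by omega]
    · simp only [h0, hj, if_false, or_self]
      field_simp

theorem deriv_formula {F G0 : ℂ → ℂ} (dF : Differentiable ℂ F) (dG : Differentiable ℂ G0)
    {Fr : ℝ → ℝ} (hFr : ∀ x : ℝ, F x = Fr x)
    {C0 C S : ℝ} (hC0 : 0 < C0) (hC : 0 ≤ C)
    (hF : ∀ s : ℂ, S ≤ ‖s‖ → ‖F (s^2) + (C0:ℂ) * (s * Complex.sin (π * s))‖ ≤ C * rexp (π * |s.im|))
    (hG : ∀ s, G0 (s^2) = -(s * Complex.sin (π * s)))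
    (hGz : ∀ l, G0 l = 0 ↔ ∃ j : ℕ, l = (j:ℂ)^2) (hGd : ∀ l, G0 l = 0 → deriv G0 l ≠ 0)
    {μ : ℕ → ℝ} (hμ : StrictMono μ) (hFz : ∀ l, F l = 0 ↔ ∃ j, l = (μ j : ℂ)) 
    (hFd : ∀ l, F l = 0 → deriv F l ≠ 0) (n : ℕ) (hn : 1 ≤ n) (hw : G0 (μ n) ≠ 0) :
    Multipliable (fun k : ℕ => if k = 0 ∨ k = n then (1:ℝ) else (μ k - μ n) / (k : ℝ) ^ 2) ∧
    deriv F (μ n) = ((-(π / (n : ℝ) ^ 2) * (μ 0 - μ n) * C0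
            * ∏' k : ℕ, (if k = 0 ∨ k = n then (1:ℝ) else (μ k - μ n) / (k : ℝ) ^ 2) : ℝ) : ℂ) := by
  obtain ⟨C2, hC2⟩ := indexing dF dG hFr hC0 hC hF hG hGz hGd hμ hFz hFd
  have hm := mult_p hC2 n
  refine ⟨hm, ?_⟩
  set p : ℕ → ℝ := fun k => if k = 0 ∨ k = n then (1:ℝ) else (μ k - μ n) / (k : ℝ) ^ 2 with hp
  have hC2' : 0 ≤ C2 := (abs_nonneg _).trans (hC2 0)
  have hr := ratio_hyp (F := F) (G0 := G0) hC0 hC hG hF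
  have hC0' : (C0:ℂ) ≠ 0 := by exact_mod_cast hC0.ne'
  have hμi : Function.Injective (fun j => ((μ j : ℝ) : ℂ)) := fun a b h => hμ.injective (Complex.ofReal_injective h)
  have dG' : Differentiable ℂ (fun z => (C0:ℂ) * G0 z) := dG.const_mul _
  have hGz' : ∀ l, (C0:ℂ) * G0 l = 0 ↔ ∃ j : ℕ, l = (j:ℂ)^2 := by
    intro l; rw [← hGz]; simp [hC0']
  have hGd' : ∀ l, (C0:ℂ) * G0 l = 0 → deriv (fun z => (C0:ℂ) * G0 z) l ≠ 0 := by
    intro l hl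
    rw [deriv_const_mul _ (dG l)]
    exact mul_ne_zero hC0' (hGd l ((mul_eq_zero.1 hl).resolve_left hC0'))
  have L := compL (F := F) (G := fun z => (C0:ℂ) * G0 z) dF dG' (f := fun j => ((μ j : ℝ) : ℂ))
      (g := fun j => (j:ℂ)^2) hμi (fun a b h => by
        have h' : (a:ℂ)^2 = (b:ℂ)^2 := h
        have : a^2 = b^2 := by exact_mod_cast h'
        exact Nat.pow_left_injective (n := 2) (by norm_num) this) (fun z hz => (hGz' z).1 hz)
        (fun j => (hGz' _).2 ⟨j, rfl⟩) (fun j => hGd' _ ((hGz' _).2 ⟨j, rfl⟩)) (fun j => (hFz _).2 ⟨_, rfl⟩)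
        (C := C2) (d := 0) (fun j => by rw [nrm_aux]; simpa using hC2 j) (fun j => by simpa using hC2') hr
  set w : ℂ := ((μ n : ℝ) : ℂ) with hwdef
  obtain ⟨s, hs⟩ := IsAlgClosed.exists_pow_nat_eq w (n := 2) (by norm_num)
  have hG0 : G0 w = -(s * Complex.sin (π * s)) := by rw [← hs, hG]
  have hs0 : s ≠ 0 := by
    intro h; rw [hG0, h] at hw; simp at hw
  have hsin0 : Complex.sin (π * s) ≠ 0 := by
    intro h; rw [hG0, h] at hw; simp at hw
  have hpi : (π:ℂ) ≠ 0 := by exact_mod_cast Real.pi_ne_zero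
  have hn0 : (n:ℂ) ≠ 0 := by exact_mod_cast (by omega : n ≠ 0)
  set E : ℕ → ℂ := fun M => ∏ j ∈ Finset.range M, (1 - s ^ 2 / ((j:ℂ) + 1) ^ 2) with hE
  have hEul := Complex.tendsto_euler_sin_prod s
  have hP := (hm.hasProd.tendsto_prod_nat)
  set P : ℝ := ∏' k : ℕ, p k with hPdef
  have hP1 : Filter.Tendsto (fun M => ((∏ i ∈ Finset.range (M+1), p i : ℝ) : ℂ)) Filter.atTop (nhds (P:ℂ)) :=
    (Complex.continuous_ofReal.tendsto P).comp (hP.comp (Filter.tendsto_add_atTop_nat 1))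
  set T : ℕ → ℂ := fun M => ((π:ℂ) * C0 * (μ 0 - μ n) / (n:ℂ)^2) * ((∏ i ∈ Finset.range (M+1), p i : ℝ) : ℂ) *
    (Complex.sin (π * s) / (π * s * E M)) with hT
  set T0 : ℂ := ((π:ℂ) * C0 * (μ 0 - μ n) / (n:ℂ)^2) * (P:ℂ) with hT0
  have hTt : Filter.Tendsto T Filter.atTop (nhds T0) := by
    have h1 : Filter.Tendsto (fun M => Complex.sin (π * s) / (π * s * E M)) Filter.atTop (nhds 1) := by
      have := (tendsto_const_nhds (x := Complex.sin (π * s)) (f := Filter.atTop)).div hEul hsin0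
      rwa [div_self hsin0] at this
    have := (hP1.const_mul ((π:ℂ) * C0 * (μ 0 - μ n) / (n:ℂ)^2)).mul h1
    rwa [mul_one] at this
  have hEne : ∀ M, E M ≠ 0 := by
    intro M
    rw [hE]
    apply Finset.prod_ne_zero_iff.2
    intro j _ h
    apply hw
    have hj : ((j:ℂ)+1) ≠ 0 := by exact_mod_cast Nat.succ_ne_zero j
    refine (hGz _).2 ⟨j+1, ?_⟩
    rw [← hs]
    field_simp at h
    push_cast
    linear_combination -h
  have key : ∀ ε > 0, ∀ᶠ M in Filter.atTop, ‖deriv F w + T M‖ ≤ ε * ‖T M‖ := by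
    intro ε hε
    obtain ⟨N0, h⟩ := L ε hε
    obtain ⟨M0, hM0⟩ := exists_nat_gt (‖w‖ + 1)
    refine Filter.eventually_atTop.2 ⟨N0 + n + M0, fun M hM => ?_⟩
    obtain ⟨A, B, dA, dB, hA, hB, H⟩ := h (M+1) (by omega)
    have hM0' : (M0:ℝ) ≤ M := by exact_mod_cast (by omega : M0 ≤ M)
    obtain ⟨h1, h2⟩ := H w (by
      push_cast
      have := norm_nonneg w
      nlinarith)
    have hmem : n ∈ Finset.range (M+1) := Finset.mem_range.2 (by omega)
    set X := ∏ j ∈ (Finset.range (M+1)).erase n, (((μ j:ℝ):ℂ) - w) with hX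
    have hder : deriv F w = - A w * X := by
      have e : F = fun z => (A z * ∏ j ∈ (Finset.range (M+1)).erase n, (((μ j:ℝ):ℂ) - z)) * (w - z) := by
        ext z
        rw [hA z, ← Finset.mul_prod_erase _ _ hmem]; ring
      have d1 : DifferentiableAt ℂ (fun z => (A z * ∏ j ∈ (Finset.range (M+1)).erase n, (((μ j:ℝ):ℂ) - z))) w := by
        fun_prop
      have d2 : HasDerivAt (fun z => w - z) (-1) w := (hasDerivAt_id w).const_sub w
      rw [e]
      refine (d1.hasDerivAt.mul d2).deriv.trans ?_
      rw [← hX]; ring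
    have hTB : T M = B w * X := by
      have hBw := hB w
      have hXid : X * (n:ℂ)^2 = ((μ 0 : ℂ) - w) * ((∏ i ∈ Finset.range (M+1), p i : ℝ) : ℂ) * ∏ i ∈ Finset.range M, ((i:ℂ)+1)^2 := by
        have := congrArg (fun x : ℝ => (x:ℂ)) (prod_id μ n hn M (by omega))
        beta_reduce at this
        rw [Complex.ofReal_mul, Complex.ofReal_mul, Complex.ofReal_mul, Complex.ofReal_prod, Complex.ofReal_prod (f := fun i : ℕ => ((i:ℝ)+1)^2)] at this
        rw [hX]
        push_cast at this ⊢
        exact this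
      have hZ : ∏ j ∈ Finset.range (M+1), ((j:ℂ)^2 - w) = -s^2 * (∏ i ∈ Finset.range M, ((i:ℂ)+1)^2) * E M := by
        rw [Finset.prod_range_succ', hE, mul_assoc, ← Finset.prod_mul_distrib, mul_comm, ← hs]
        congr 1
        · simp
        · apply Finset.prod_congr rfl
          intro j _
          have hj : ((j:ℂ)+1) ≠ 0 := by exact_mod_cast Nat.succ_ne_zero j
          push_cast
          field_simp
      rw [hZ, hG0] at hBw
      set Pi := ∏ i ∈ Finset.range M, ((i:ℂ)+1)^2 with hPi
      set pp := ((∏ i ∈ Finset.range (M+1), p i : ℝ) : ℂ) with hpp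
      have hEM := hEne M
      have hX2 : X = (((μ 0 : ℂ) - w) * pp * Pi) / (n:ℂ)^2 := by
        rw [← hXid]; field_simp
      have hb : Complex.sin (π * s) * C0 = B w * s * Pi * E M := by
        apply mul_left_cancel₀ hs0
        linear_combination -hBw
      rw [hX2, hT]
      beta_reduce
      rw [← hpp]
      field_simp
      linear_combination (μ 0 - w) * pp * hb
    rw [hder, hTB]
    have : - A w * X + B w * X = -((A w - B w) * X) := by ring
    rw [this, norm_neg, norm_mul, norm_mul, ← mul_assoc]
    gcongr
  have fin : ‖deriv F w + T0‖ ≤ 0 := by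
    have hle : ∀ ε > 0, ‖deriv F w + T0‖ ≤ ε * ‖T0‖ := fun ε hε =>
      le_of_tendsto_of_tendsto (hTt.const_add _).norm (hTt.norm.const_mul ε) (key ε hε)
    by_contra hcon
    push Not at hcon
    have := hle (‖deriv F w + T0‖ / (2 * (‖T0‖ + 1))) (by positivity)
    have h0 := norm_nonneg T0
    rw [div_mul_eq_mul_div, le_div_iff₀ (by positivity)] at this
    nlinarith
  have := norm_le_zero_iff.1 fin
  rw [eq_neg_of_add_eq_zero_left this, hT0]
  push_cast
  ring


theorem isSol_csol {q : ℝ → ℝ} (hq : IntegrableOn q (Icc 0 π)) {lam : ℝ} {y y' : ℝ → ℝ} (h : IsSol q lam y y') (c : ℝ) :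
    CSol (fun t => q t + c) ((lam + c : ℝ) : ℂ) (fun x => (y x : ℂ)) (fun x => (y' x : ℂ)) := by
  obtain ⟨h1, h2⟩ := h
  have cy : ContinuousOn y (Icc 0 π) := fun x hx => (h1 x hx).continuousAt.continuousWithinAt
  have hqi : IntervalIntegrable q volume 0 π := (intervalIntegrable_iff_integrableOn_Icc_of_le Real.pi_pos.le).2 hq
  have hi : IntervalIntegrable (fun t => (q t - lam) * y t) volume 0 π :=
    (hqi.sub intervalIntegrable_const).mul_continuousOn (by rwa [uIcc_of_le Real.pi_pos.le])
  have cy' : ContinuousOn y' (Icc 0 π) := by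
    have := intervalIntegral.continuousOn_primitive_interval' hi (a := 0) (by simp)
    rw [uIcc_of_le Real.pi_pos.le] at this
    exact (continuousOn_const (c := y' 0)).add this |>.congr h2
  refine ⟨Complex.continuous_ofReal.comp_continuousOn cy, Complex.continuous_ofReal.comp_continuousOn cy', ?_, ?_⟩
  · intro x hx
    beta_reduce
    rw [intervalIntegral.integral_ofReal, intervalIntegral.integral_eq_sub_of_hasDerivAt (f := y)]
    · push_cast; ring
    · intro t ht
      rw [uIcc_of_le hx.1] at ht
      exact h1 t ⟨ht.1, ht.2.trans hx.2⟩
    · apply ContinuousOn.intervalIntegrable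
      rw [uIcc_of_le hx.1]
      exact cy'.mono (Icc_subset_Icc le_rfl hx.2)
  · intro x hx
    beta_reduce
    have e : ∀ t, (((q t + c : ℝ) : ℂ) - ((lam + c : ℝ) : ℂ)) * (y t : ℂ) = (((q t - lam) * y t : ℝ) : ℂ) := by
      intro t; push_cast; ring
    simp_rw [e]
    rw [intervalIntegral.integral_ofReal, h2 x hx]
    push_cast; rfl

theorem csol_smul {q : ℝ → ℝ} {l : ℂ} {y z : ℝ → ℂ} (h : CSol q l y z) (k : ℂ) :
    CSol q l (fun x => k * y x) (fun x => k * z x) := by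
  obtain ⟨a, b, c, d⟩ := h
  refine ⟨continuousOn_const.mul a, continuousOn_const.mul b, ?_, ?_⟩
  · intro x hx
    beta_reduce
    rw [intervalIntegral.integral_const_mul, c x hx]; ring
  · intro x hx
    beta_reduce
    rw [d x hx, mul_add, ← intervalIntegral.integral_const_mul]
    congr 2; ext t; ring

theorem statement11 (q : ℝ → ℝ) (hq : IntegrableOn q (Set.Icc (0 : ℝ) π))
    (α β : ℝ) (hα : α ∈ Set.Ioo (0 : ℝ) π) (hβ : β ∈ Set.Ioo (0 : ℝ) π)
    (μ : ℕ → ℝ) (hmono : StrictMono μ)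
    (henum : ∀ lam : ℝ, IsEigenvalue q α β lam ↔ ∃ n : ℕ, μ n = lam)
    (φ φ' : ℝ → ℝ → ℝ)
    (hsol : ∀ lam : ℝ, IsSol q lam (φ lam) (φ' lam))
    (h0 : ∀ lam : ℝ, φ lam 0 = Real.sin α)
    (h0' : ∀ lam : ℝ, φ' lam 0 = -Real.cos α)
    (hdiff : ∀ n : ℕ, DifferentiableAt ℝ
      (fun lam => φ lam π * Real.cos β + φ' lam π * Real.sin β) (μ n)) :
    ∀ n : ℕ, 1 ≤ n →
      Multipliable (fun k : ℕ =>
        if k = 0 ∨ k = n then 1 else (μ k - μ n) / (k : ℝ) ^ 2) ∧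
      deriv (fun lam => φ lam π * Real.cos β + φ' lam π * Real.sin β) (μ n)
        = -(π / (n : ℝ) ^ 2) * (μ 0 - μ n) * Real.sin α * Real.sin β
            * ∏' k : ℕ, (if k = 0 ∨ k = n then 1 else (μ k - μ n) / (k : ℝ) ^ 2) := by
  intro n hn
  set c : ℝ := 1/2 - μ n with hc
  have hsα : 0 < Real.sin α := Real.sin_pos_of_mem_Ioo hα
  have hsβ : 0 < Real.sin β := Real.sin_pos_of_mem_Ioo hβ
  have hqi : IntervalIntegrable q volume 0 π := (intervalIntegrable_iff_integrableOn_Icc_of_le Real.pi_pos.le).2 hq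
  have hQ : QI (fun t => q t + c) := by
    have : IntervalIntegrable (fun t => q t + c) volume 0 π := hqi.add intervalIntegrable_const
    exact ⟨this.1.ofReal, this.2.ofReal⟩
  obtain ⟨F, dF, him, hsimp, hval, C, S, hC, -, hF⟩ := char_exists hQ (α := α) (β := β) hsα.ne'
  obtain ⟨G0, dG, hG, hGz, hGd⟩ := G_exists
  have hcs := fun lam => isSol_csol hq (hsol lam) c
  set Φ : ℝ → ℝ := fun lam => φ lam π * Real.cos β + φ' lam π * Real.sin β with hΦ
  have hFΦ : ∀ lam : ℝ, F ((lam + c : ℝ) : ℂ) = (Φ lam : ℂ) := by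
    intro lam
    rw [hval _ _ _ (hcs lam) (by rw [h0]) (by rw [h0']), hΦ]
    push_cast; rfl
  have hFr : ∀ x : ℝ, F x = ((fun x => Φ (x - c)) x : ℝ) := by
    intro x
    have := hFΦ (x - c)
    rwa [sub_add_cancel] at this
  have hFz : ∀ l, F l = 0 ↔ ∃ j, l = ((μ j + c : ℝ) : ℂ) := by
    intro l
    constructor
    · intro hl
      have him' := him l hl
      obtain ⟨x, rfl⟩ : ∃ x : ℝ, l = x := ⟨l.re, Complex.ext (by simp) (by simp [him'])⟩
      rw [hFr] at hl
      have hl' : Φ (x - c) = 0 := by exact_mod_cast hl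
      have : IsEigenvalue q α β (x - c) := by
        refine ⟨φ (x - c), φ' (x - c), hsol _, ⟨0, mem0, by rw [h0]; exact hsα.ne'⟩, ?_, hl'⟩
        rw [h0, h0']; ring
      obtain ⟨j, hj⟩ := (henum _).1 this
      exact ⟨j, by rw [hj, sub_add_cancel]⟩
    · rintro ⟨j, rfl⟩
      obtain ⟨y, y', hy, ⟨x, hx, hyx⟩, b1, b2⟩ := (henum (μ j)).2 ⟨j, rfl⟩
      rw [hFΦ]
      set k : ℝ := y 0 / Real.sin α with hk
      have e1 : y 0 = k * Real.sin α := by rw [hk]; field_simp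
      have e2 : y' 0 = k * (-Real.cos α) := by
        apply mul_right_cancel₀ hsα.ne'
        linear_combination b1 - Real.cos α * e1
      have hu := csol_unique hQ (isSol_csol hq hy c) (csol_smul (hcs (μ j)) (k:ℂ))
        (by beta_reduce; rw [e1, h0]; push_cast; rfl) (by beta_reduce; rw [e2, h0']; push_cast; rfl)
      have hk0 : k ≠ 0 := by
        intro h
        have := (hu x hx).1
        rw [h] at this
        simp at this
        exact hyx this
      have u1 : y π = k * φ (μ j) π := by exact_mod_cast (hu π memπ).1
      have u2 : y' π = k * φ' (μ j) π := by exact_mod_cast (hu π memπ).2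
      have : k * Φ (μ j) = 0 := by
        rw [u1, u2] at b2
        rw [hΦ]; linear_combination b2
      rw [(mul_eq_zero.1 this).resolve_left hk0]; simp
  have hw : G0 ((μ n + c : ℝ) : ℂ) ≠ 0 := by
    intro h
    obtain ⟨j, hj⟩ := (hGz _).1 h
    have h1 : μ n + c = (j:ℝ)^2 := by exact_mod_cast hj
    rw [hc] at h1
    have h2 : (1:ℝ) = 2 * (j:ℝ)^2 := by linarith
    have h3 : 1 = 2 * j^2 := by exact_mod_cast h2
    omega
  obtain ⟨m1, m2⟩ := deriv_formula dF dG hFr (mul_pos hsα hsβ) hC hF hG hGz hGd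
    (μ := fun j => μ j + c) (fun a b hab => by have := hmono hab; beta_reduce; linarith) hFz hsimp n hn hw
  simp only [add_sub_add_right_eq_sub] at m1 m2
  refine ⟨m1, ?_⟩
  have d1 : HasDerivAt (fun z : ℂ => F (z + (c:ℂ))) (deriv F ((μ n + c : ℝ) : ℂ)) ((μ n : ℝ) : ℂ) := by
    apply HasDerivAt.comp_add_const
    push_cast
    exact (dF _).hasDerivAt
  have d2 := d1.real_of_complex
  have e : (fun x : ℝ => (F ((x:ℂ) + (c:ℂ))).re) = Φ := by
    ext x
    have := hFΦ x
    push_cast at this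
    rw [this]; simp
  rw [e] at d2
  rw [d2.deriv, m2, Complex.ofReal_re]
  ring
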